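/- Let N ∈ {4,5}, m ≥ 2, λ̄ > 0, and let (λ_n) → λ̄ and (u_n) be radial solutions of the Brezis–Nirenberg problem with m nodal zones for λ_n, with first zeros r_n, such that u_n(0) → ∞. Set M_n = sup_{r_n ≤ r ≤ 1}|u_n(r)|. Then λ̄ = μ_{m−1}, u_n(r)/M_n → ψ_{m−1}(r) uniformly together with first derivatives on compact subsets of (0,1], M_n → 0, and precisely: if N = 4 then M_n·r_n²·u_n(0) → 8; if N = 5 then M_n/r_n^{3/2} → (5/3)^{3/4}·(π μ_{m−1}/8)^{3/2}. -/

import Mathlib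

open Real Set Filter Topology

/-- A radial solution of the Brezis–Nirenberg problem `-Δu = |u|^{4/(N-2)} u + λ u`
on the unit ball of `ℝ^N` with `m` nodal zones: a `C²` function `u` on `[0,1]`
(given together with its first and second derivatives `u'`, `u''`) satisfying the
radial ODE, `u'(0) = 0`, `u(1) = 0`, `u(0) > 0`, with exactly `m - 1` zeros in `(0,1)`. -/
structure BNSol (N : ℕ) (lam : ℝ) (m : ℕ) (u u' u'' : ℝ → ℝ) : Prop where
  deriv_fst : ∀ r ∈ Set.Icc (0:ℝ) 1, HasDerivWithinAt u (u' r) (Set.Icc (0:ℝ) 1) r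
  deriv_snd : ∀ r ∈ Set.Icc (0:ℝ) 1, HasDerivWithinAt u' (u'' r) (Set.Icc (0:ℝ) 1) r
  cont_snd : ContinuousOn u'' (Set.Icc (0:ℝ) 1)
  ode : ∀ r ∈ Set.Ioo (0:ℝ) 1,
    u'' r + (((N:ℝ) - 1) / r) * u' r + |u r| ^ ((4:ℝ) / ((N:ℝ) - 2)) * u r + lam * u r = 0
  bc_deriv_zero : u' 0 = 0
  bc_one : u 1 = 0
  pos_zero : 0 < u 0
  nodal : {r : ℝ | r ∈ Set.Ioo (0:ℝ) 1 ∧ u r = 0}.ncard = m - 1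

/-- `ρ` is the first zero of `u` in `(0,1]`. -/
def IsFirstZero (u : ℝ → ℝ) (ρ : ℝ) : Prop :=
  ρ ∈ Set.Ioc (0:ℝ) 1 ∧ u ρ = 0 ∧ ∀ s ∈ Set.Ioo (0:ℝ) ρ, u s ≠ 0

/-- `(μ, ψ)` is the `h`-th radial Dirichlet eigenpair of `-Δ` on the unit ball of `ℝ^N`:
`ψ` (with derivatives `ψ'`, `ψ''`) solves the radial eigenvalue ODE with eigenvalue `μ`,
is normalized by `ψ(0) = -1`, and has exactly `h - 1` zeros in `(0,1)`. -/
structure RadialEigenpair (N : ℕ) (μ : ℝ) (ψ ψ' ψ'' : ℝ → ℝ) (h : ℕ) : Prop where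
  pos : 0 < μ
  deriv_fst : ∀ r ∈ Set.Icc (0:ℝ) 1, HasDerivWithinAt ψ (ψ' r) (Set.Icc (0:ℝ) 1) r
  deriv_snd : ∀ r ∈ Set.Icc (0:ℝ) 1, HasDerivWithinAt ψ' (ψ'' r) (Set.Icc (0:ℝ) 1) r
  ode : ∀ r ∈ Set.Ioo (0:ℝ) 1, ψ'' r + (((N:ℝ) - 1) / r) * ψ' r + μ * ψ r = 0
  bc_deriv_zero : ψ' 0 = 0
  bc_one : ψ 1 = 0
  norm_zero : ψ 0 = -1
  nodal : {r : ℝ | r ∈ Set.Ioo (0:ℝ) 1 ∧ ψ r = 0}.ncard = h - 1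


lemma cmp_le {f g f' g' : ℝ → ℝ} {a b : ℝ} (hab : a ≤ b)
    (hf : ContinuousOn f (Icc a b)) (hg : ContinuousOn g (Icc a b))
    (hf' : ∀ x ∈ Ioo a b, HasDerivAt f (f' x) x)
    (hg' : ∀ x ∈ Ioo a b, HasDerivAt g (g' x) x)
    (h : ∀ x ∈ Ioo a b, f' x ≤ g' x) : f b - f a ≤ g b - g a := by
  have hm : MonotoneOn (fun x => g x - f x) (Icc a b) := by
    apply monotoneOn_of_hasDerivWithinAt_nonneg (convex_Icc a b) (f' := fun x => g' x - f' x)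
      (hg.sub hf)
    · intro x hx
      rw [interior_Icc] at hx
      exact ((hg' x hx).sub (hf' x hx)).hasDerivWithinAt
    · intro x hx
      rw [interior_Icc] at hx
      linarith [h x hx]
  have := hm (left_mem_Icc.2 hab) (right_mem_Icc.2 hab) hab
  simp only at this
  linarith

lemma cmp_lt {f g f' g' : ℝ → ℝ} {a b : ℝ} (hab : a < b)
    (hf : ContinuousOn f (Icc a b)) (hg : ContinuousOn g (Icc a b))
    (hf' : ∀ x ∈ Ioo a b, HasDerivAt f (f' x) x)
    (hg' : ∀ x ∈ Ioo a b, HasDerivAt g (g' x) x)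
    (h : ∀ x ∈ Ioo a b, f' x < g' x) : f b - f a < g b - g a := by
  have hm : StrictMonoOn (fun x => g x - f x) (Icc a b) := by
    apply strictMonoOn_of_deriv_pos (convex_Icc a b) (hg.sub hf)
    intro x hx
    rw [interior_Icc] at hx
    rw [((hg' x hx).sub (hf' x hx)).deriv]
    linarith [h x hx]
  have := hm (left_mem_Icc.2 hab.le) (right_mem_Icc.2 hab.le) hab
  simp only at this
  linarith

lemma hasDerivAt_pow' (k : ℕ) {r : ℝ} (hr : r ≠ 0) :
    HasDerivAt (fun x : ℝ => x ^ k) ((k:ℝ) * r ^ k / r) r := by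
  have h := hasDerivAt_pow k r
  refine HasDerivAt.congr_deriv (h) ?_
  rcases k with _ | k
  · simp
  · simp only [Nat.add_sub_cancel]
    field_simp
    ring

/-- Solutions of the radial linear equation with potential `V`. -/
structure LSol (k : ℕ) (V u u' : ℝ → ℝ) : Prop where
  cu : ContinuousOn u (Icc 0 1)
  cu' : ContinuousOn u' (Icc 0 1)
  du : ∀ r ∈ Ioo (0:ℝ) 1, HasDerivAt u (u' r) r
  du' : ∀ r ∈ Ioo (0:ℝ) 1, HasDerivAt u' (-((k:ℝ) / r) * u' r - V r * u r) r

lemma LSol.hW {k : ℕ} {V u u' : ℝ → ℝ} (h : LSol k V u u') {r : ℝ} (hr : r ∈ Ioo (0:ℝ) 1) :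
    HasDerivAt (fun x => x ^ k * u' x) (-(r ^ k * (V r * u r))) r := by
  have hr0 : r ≠ 0 := hr.1.ne'
  refine HasDerivAt.congr_deriv ((hasDerivAt_pow' k hr0).mul (h.du' r hr)) ?_
  field_simp
  ring

lemma LSol.cW {k : ℕ} {V u u' : ℝ → ℝ} (h : LSol k V u u') :
    ContinuousOn (fun x => x ^ k * u' x) (Icc 0 1) :=
  (continuous_pow k).continuousOn.mul h.cu'

/-- The first bump. -/
structure Bump (k : ℕ) (ν lam γ a ρ : ℝ) (u u' : ℝ → ℝ) : Prop where
  sol : LSol k (fun r => |u r| ^ (2 / ν) + lam) u u'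
  u0 : u 0 = γ
  γpos : 0 < γ
  lpos : 0 < lam
  νpos : 0 < ν
  kν : (k:ℝ) = 2 * ν + 1
  adef : a = γ ^ (2 / ν) / (4 * ν * (ν + 1))
  ρ0 : 0 < ρ
  ρ1 : ρ < 1
  uρ : u ρ = 0
  pos : ∀ r ∈ Ico 0 ρ, 0 < u r
  u1 : u 1 = 0

namespace Bump
variable {k : ℕ} {ν lam γ a ρ : ℝ} {u u' : ℝ → ℝ}

lemma k0 (h : Bump k ν lam γ a ρ u u') : k ≠ 0 := by
  intro hk
  have := h.kν
  have := h.νpos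
  subst hk
  simp at *
  linarith

lemma apos (h : Bump k ν lam γ a ρ u u') : 0 < a := by
  have := h.νpos
  have := h.γpos
  rw [h.adef]
  positivity

lemma neg (h : Bump k ν lam γ a ρ u u') {r : ℝ} (hr : r ∈ Ioc 0 ρ) : u' r < 0 := by
  have hr1 : r < 1 := lt_of_le_of_lt hr.2 h.ρ1
  have hsub : Icc 0 r ⊆ Icc 0 1 := Icc_subset_Icc_right hr1.le
  have := cmp_lt (g := fun _ => 0) (g' := fun _ => 0) hr.1 (h.sol.cW.mono hsub) continuousOn_const
    (fun x hx => h.sol.hW ⟨hx.1, hx.2.trans hr1⟩) (fun x hx => hasDerivAt_const x 0) (by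
      intro x hx
      have hp := h.pos x ⟨hx.1.le, hx.2.trans_le hr.2⟩
      have hl := h.lpos
      have hx0 := hx.1
      have : 0 < x ^ k * ((|u x| ^ (2 / ν) + lam) * u x) := by positivity
      linarith)
  simp only [zero_pow h.k0] at this
  have hrk : 0 < r ^ k := pow_pos hr.1 k
  by_contra hc
  push Not at hc
  nlinarith [mul_nonneg hrk.le hc]

lemma anti (h : Bump k ν lam γ a ρ u u') {s r : ℝ} (hs : 0 ≤ s) (hsr : s ≤ r) (hr : r ≤ ρ) :
    u r ≤ u s := by
  have hsub : Icc s r ⊆ Icc 0 1 := Icc_subset_Icc hs (hr.trans h.ρ1.le)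
  have := cmp_le (g := fun _ => 0) (g' := fun _ => 0) hsr (h.sol.cu.mono hsub) continuousOn_const
    (fun x hx => h.sol.du x ⟨hs.trans_lt hx.1, (hx.2.trans_le hr).trans h.ρ1⟩)
    (fun x hx => hasDerivAt_const x 0)
    (fun x hx => (h.neg ⟨hs.trans_lt hx.1, (hx.2.trans_le hr).le⟩).le)
  linarith

lemma nonneg (h : Bump k ν lam γ a ρ u u') {r : ℝ} (hr : r ∈ Icc 0 ρ) : 0 ≤ u r := by
  rw [← h.uρ]
  exact h.anti hr.1 hr.2 le_rfl

lemma le_γ (h : Bump k ν lam γ a ρ u u') {r : ℝ} (hr : r ∈ Icc 0 ρ) : u r ≤ γ := by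
  rw [← h.u0]
  exact h.anti le_rfl hr.1 hr.2

lemma brk (h : Bump k ν lam γ a ρ u u') {r : ℝ} (hr : r ∈ Ico 0 ρ) :
    0 ≤ ν * (r ^ k * u' r) * u r + r ^ (k+1) *
      (u' r ^ 2 / 2 + (u r ^ (2/ν+2) + lam * u r ^ 2) / (2/ν+2)) := by
  have hr1 : r < 1 := lt_trans hr.2 h.ρ1
  have hsub : Icc 0 r ⊆ Icc 0 1 := Icc_subset_Icc_right hr1.le
  have hν := h.νpos
  have hcu := h.sol.cu.mono hsub
  have hcu' := h.sol.cu'.mono hsub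
  have := cmp_le (f := fun _ => 0) (f' := fun _ => 0)
    (g := fun r => ν * (r ^ k * u' r) * u r + r ^ (k+1) *
      (u' r ^ 2 / 2 + (u r ^ (2/ν+2) + lam * u r ^ 2) / (2/ν+2)))
    (g' := fun r => - (lam / (ν+1)) * r ^ (k+1) * u r * u' r) hr.1 continuousOn_const
    (by
      have h3 : ContinuousOn (fun r => u r ^ (2/ν+2)) (Icc 0 r) :=
        hcu.rpow_const (fun x _ => Or.inr (by positivity))
      fun_prop) (fun x hx => hasDerivAt_const x 0) (by
      intro x hx
      have hx1 : x ∈ Ioo (0:ℝ) 1 := ⟨hx.1, hx.2.trans hr1⟩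
      have hp := h.pos x ⟨hx.1.le, hx.2.trans hr.2⟩
      have hx0 : x ≠ 0 := hx.1.ne'
      have d1 := h.sol.du x hx1
      have d2 := h.sol.du' x hx1
      have d3 := h.sol.hW hx1
      have d4 := hasDerivAt_pow' (k+1) hx0
      have d5 := d1.rpow_const (p := 2/ν+2) (Or.inl hp.ne')
      have d6 := ((d3.const_mul ν).mul d1).add (d4.mul (((d2.fun_pow 2).div_const 2).add
        ((d5.add ((d1.fun_pow 2).const_mul lam)).div_const (2/ν+2))))
      refine HasDerivAt.congr_deriv (d6) ?_
      have e1 : u x ^ (2/ν+2-1) = u x ^ (2/ν) * u x := by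
        rw [show 2/ν+2-1 = 2/ν + 1 by ring, rpow_add hp, rpow_one]
      have e2 : u x ^ (2/ν+2) = u x ^ (2/ν) * u x ^ 2 := by
        rw [rpow_add hp]; norm_num
      simp only [Pi.add_apply]
      rw [e1, e2, abs_of_pos hp]
      have hk := h.kν
      push_cast
      rw [hk]
      generalize u x ^ (2/ν) = Y
      field_simp
      ring) (by
      intro x hx
      have hp := h.pos x ⟨hx.1.le, hx.2.trans hr.2⟩
      have hn := h.neg ⟨hx.1, (hx.2.trans hr.2).le⟩
      have hl := h.lpos
      have hx0 := hx.1
      have : 0 ≤ (lam / (ν+1)) * x ^ (k+1) * u x * (- u' x) := by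
        have : 0 < - u' x := by linarith
        positivity
      linarith)
  simp only [zero_pow h.k0, zero_pow (Nat.succ_ne_zero k)] at this
  linarith

lemma q_mono (h : Bump k ν lam γ a ρ u u') {s r : ℝ} (hs : 0 < s) (hsr : s ≤ r) (hr : r < ρ) :
    -(u' s) * u s ^ (-(1+1/ν)) / s ≤ -(u' r) * u r ^ (-(1+1/ν)) / r := by
  have hν := h.νpos
  have hsub : Icc s r ⊆ Icc 0 1 := Icc_subset_Icc hs.le (hr.le.trans h.ρ1.le)
  have hcu := h.sol.cu.mono hsub
  have hcu' := h.sol.cu'.mono hsub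
  have := cmp_le (f := fun _ => 0) (f' := fun _ => 0)
    (g := fun r => -(u' r) * u r ^ (-(1+1/ν)) / r)
    (g' := fun r => u r ^ (-(1+1/ν)) / r * (2 * (1+1/ν) / (u r * r^(k+1))) *
      (ν * (r ^ k * u' r) * u r + r ^ (k+1) *
      (u' r ^ 2 / 2 + (u r ^ (2/ν+2) + lam * u r ^ 2) / (2/ν+2)))) hsr continuousOn_const
    (by
      have h3 : ContinuousOn (fun r => u r ^ (-(1+1/ν))) (Icc s r) :=
        hcu.rpow_const (fun x hx => Or.inl (h.pos x ⟨hs.le.trans hx.1, hx.2.trans_lt hr⟩).ne')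
      exact (hcu'.neg.mul h3).div continuousOn_id (fun x hx => (hs.trans_le hx.1).ne'))
    (fun x hx => hasDerivAt_const x 0) (by
      intro x hx
      have hx00 := hs.trans hx.1
      have hx1 : x ∈ Ioo (0:ℝ) 1 := ⟨hx00, (hx.2.trans hr).trans h.ρ1⟩
      have hp := h.pos x ⟨hx00.le, hx.2.trans hr⟩
      have hx0 : x ≠ 0 := hx00.ne'
      have d1 := h.sol.du x hx1
      have d2 := h.sol.du' x hx1
      have d5 := d1.rpow_const (p := -(1+1/ν)) (Or.inl hp.ne')
      have d6 := (d2.neg.mul d5).div (hasDerivAt_id x) hx0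
      refine HasDerivAt.congr_deriv (d6) ?_
      have e1 : u x ^ (-(1+1/ν)-1) = u x ^ (-(1+1/ν)) / u x := by
        rw [rpow_sub hp, rpow_one]
      have e2 : u x ^ (2/ν+2) = u x ^ (2/ν) * u x ^ 2 := by
        rw [rpow_add hp]; norm_num
      simp only [Pi.mul_apply, Pi.neg_apply, id]
      rw [e1, e2, abs_of_pos hp]
      have hk := h.kν
      rw [hk]
      generalize u x ^ (2/ν) = Y
      generalize u x ^ (-(1+1/ν)) = Z
      field_simp
      ring) (by
      intro x hx
      have hx00 := hs.trans hx.1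
      have hp := h.pos x ⟨hx00.le, hx.2.trans hr⟩
      have := h.brk ⟨hx00.le, hx.2.trans hr⟩
      positivity)
  linarith

lemma q_low (h : Bump k ν lam γ a ρ u u') {r : ℝ} (hr0 : 0 < r) (hr : r < ρ) :
    u r ^ (1/ν) / (k+1) ≤ -(u' r) * u r ^ (-(1+1/ν)) / r := by
  have hν := h.νpos
  have hr1 : r < 1 := lt_trans hr h.ρ1
  have hsub : Icc 0 r ⊆ Icc 0 1 := Icc_subset_Icc_right hr1.le
  have hpr := h.pos r ⟨hr0.le, hr⟩
  have := cmp_le (g := fun x => -(u r ^ (2/ν) * u r) * (x^(k+1) / (k+1)))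
    (g' := fun x => -(u r ^ (2/ν) * u r) * x ^ k) hr0.le (h.sol.cW.mono hsub) (by fun_prop)
    (fun x hx => h.sol.hW ⟨hx.1, hx.2.trans hr1⟩) (by
      intro x hx
      have := ((hasDerivAt_pow (k+1) x).div_const ((k:ℝ)+1)).const_mul (-(u r ^ (2/ν) * u r))
      refine HasDerivAt.congr_deriv (this) ?_
      push_cast
      have : (k:ℝ) + 1 ≠ 0 := by positivity
      field_simp) (by
      intro x hx
      have hp := h.pos x ⟨hx.1.le, hx.2.trans hr⟩
      have hl := h.lpos
      have hx0 := hx.1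
      have h1 := h.anti hx.1.le hx.2.le hr.le
      have h2 : u r ^ (2/ν) ≤ u x ^ (2/ν) := rpow_le_rpow hpr.le h1 (by positivity)
      rw [abs_of_pos hp]
      have h3 : u r ^ (2/ν) * u r ≤ (u x ^ (2/ν) + lam) * u x :=
        mul_le_mul (by linarith) h1 hpr.le (by positivity)
      nlinarith [pow_pos hx0 k])
  simp only [zero_pow h.k0, zero_pow (Nat.succ_ne_zero k)] at this
  have hrk : 0 < r ^ k := pow_pos hr0 k
  have e : u r ^ (2/ν) * u r = u r ^ (1/ν) * u r ^ (1+1/ν) := by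
    rw [← rpow_add hpr]
    nth_rewrite 2 [← rpow_one (u r)]
    rw [← rpow_add hpr]
    congr 1; ring
  have h4 : u r ^ (2/ν) * u r * (r / (k+1)) ≤ -(u' r) := by
    have : r ^ k * (u r ^ (2/ν) * u r * (r / (k+1))) ≤ r^k * -(u' r) := by
      have e2 : -(u r ^ (2/ν) * u r) * (r^(k+1) / (k+1)) = -(r ^ k * (u r ^ (2/ν) * u r * (r / (k+1)))) := by
        rw [pow_succ]; ring
      rw [e2, zero_div, mul_zero, zero_mul] at this
      linarith
    exact le_of_mul_le_mul_left this hrk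
  rw [e] at h4
  rw [le_div_iff₀ hr0, rpow_neg hpr.le]
  have h5 : 0 < u r ^ (1+1/ν) := rpow_pos_of_pos hpr _
  rw [← div_eq_mul_inv, le_div_iff₀ h5]
  calc _ = u r ^ (1 / ν) * u r ^ (1 + 1 / ν) * (r / (↑k + 1)) := by ring
    _ ≤ _ := h4

lemma q_low' (h : Bump k ν lam γ a ρ u u') {r : ℝ} (hr0 : 0 < r) (hr : r < ρ) :
    γ ^ (1/ν) / (k+1) ≤ -(u' r) * u r ^ (-(1+1/ν)) / r := by
  have hν := h.νpos
  have hc : Tendsto (fun s => u s ^ (1/ν) / (k+1)) (𝓝[Ioo 0 r] 0) (𝓝 (γ ^ (1/ν) / (k+1))) := by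
    have h1 : Tendsto u (𝓝[Ioo 0 r] 0) (𝓝 γ) := by
      rw [← h.u0]
      exact (h.sol.cu 0 (by simp)).mono_left (nhdsWithin_mono _ (fun x hx => ⟨hx.1.le, by linarith [hx.2, h.ρ1]⟩))
    exact (h1.rpow_const (Or.inl h.γpos.ne')).div_const _
  have : (𝓝[Ioo 0 r] (0:ℝ)).NeBot := by
    rw [nhdsWithin_Ioo_eq_nhdsGT hr0]; infer_instance
  refine le_of_tendsto hc ?_
  filter_upwards [self_mem_nhdsWithin] with s hs
  exact (h.q_low hs.1 (hs.2.trans hr)).trans (h.q_mono hs.1 hs.2.le hr)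

lemma upper (h : Bump k ν lam γ a ρ u u') {r : ℝ} (hr : r ∈ Icc 0 ρ) :
    u r ≤ γ * (1 + a * r ^ 2) ^ (-ν) := by
  have hν := h.νpos
  have ha := h.apos
  have hγ := h.γpos
  rcases eq_or_lt_of_le hr.2 with h0 | hrρ
  · rw [h0, h.uρ]; positivity
  rcases eq_or_lt_of_le hr.1 with h0 | hr0
  · rw [← h0, h.u0]; simp
  have hr1 : r < 1 := lt_trans hrρ h.ρ1
  have hsub : Icc 0 r ⊆ Icc 0 1 := Icc_subset_Icc_right hr1.le
  have hcu := h.sol.cu.mono hsub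
  have hpr := h.pos r ⟨hr0.le, hrρ⟩
  have := cmp_le (f := fun x => 1/ν * (γ ^ (1/ν) / (k+1)) * (x^2/2))
    (f' := fun x => 1/ν * (γ ^ (1/ν) / (k+1)) * x)
    (g := fun x => u x ^ (-(1/ν))) (g' := fun x => u' x * (-(1/ν)) * u x ^ (-(1/ν)-1)) hr0.le
    (by fun_prop) (hcu.rpow_const (fun x hx => Or.inl (h.pos x ⟨hx.1, hx.2.trans_lt hrρ⟩).ne'))
    (by
      intro x hx
      have := ((hasDerivAt_pow 2 x).div_const 2).const_mul (1/ν * (γ ^ (1/ν) / (k+1)))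
      refine HasDerivAt.congr_deriv (this) ?_
      simp) (by
      intro x hx
      have hp := h.pos x ⟨hx.1.le, hx.2.trans hrρ⟩
      exact (h.sol.du x ⟨hx.1, hx.2.trans hr1⟩).rpow_const (Or.inl hp.ne')) (by
      intro x hx
      have h1 := h.q_low' hx.1 (hx.2.trans hrρ)
      rw [le_div_iff₀ hx.1] at h1
      have e : -(1/ν) - 1 = -(1+1/ν) := by ring
      rw [e]
      have h2 := mul_le_mul_of_nonneg_left h1 (by positivity : 0 ≤ 1/ν)
      linarith)
  simp only [h.u0] at this
  have e1 : γ ^ (-(1/ν)) * (1 + a * r^2) ≤ u r ^ (-(1/ν)) := by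
    have e2 : γ ^ (-(1/ν)) * a = 1/ν * (γ ^ (1/ν) / (k+1)) / 2 := by
      rw [h.adef, h.kν, show 2/ν = 1/ν + 1/ν by ring, rpow_add hγ, rpow_neg hγ.le]
      have := rpow_pos_of_pos hγ (1/ν)
      field_simp
      ring
    have e3 : γ ^ (-(1/ν)) * (1 + a * r^2) = γ ^ (-(1/ν)) + (γ ^ (-(1/ν)) * a) * r^2 := by ring
    rw [e3, e2]
    nlinarith
  have hb : 0 < 1 + a * r^2 := by positivity
  have h3 := rpow_le_rpow_of_nonpos (by positivity) e1 (by linarith : -ν ≤ 0)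
  rw [← rpow_mul hpr.le, mul_rpow (by positivity) hb.le, ← rpow_mul hγ.le] at h3
  have e4 : -(1/ν) * -ν = 1 := by field_simp
  rw [e4, rpow_one, rpow_one] at h3
  exact h3

end Bump


lemma bubbleU (γ a ν : ℝ) (ha : 0 < a) (r : ℝ) :
    HasDerivAt (fun x => γ * (1 + a * x ^ 2) ^ (-ν))
      (-(2 * ν * γ * a) * r * (1 + a * r ^ 2) ^ (-ν-1)) r := by
  have hZ : 0 < 1 + a * r ^ 2 := by positivity
  have d1 : HasDerivAt (fun x => 1 + a * x ^ 2) (a * (2 * r)) r := by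
    have := ((hasDerivAt_pow 2 r).const_mul a).const_add 1
    simpa using this
  refine ((d1.rpow_const (p := -ν) (Or.inl hZ.ne')).const_mul γ).congr_deriv ?_
  ring

lemma bubbleW (k : ℕ) (γ a ν : ℝ) (hk : (k:ℝ) = 2 * ν + 1) (ha : 0 < a) {r : ℝ} (hr : r ≠ 0) :
    HasDerivAt (fun x => -(2 * ν * γ * a) * (x ^ (k+1) * (1 + a * x ^ 2) ^ (-ν-1)))
      (-(r ^ k * (4 * ν * (ν + 1) * a * γ * (1 + a * r ^ 2) ^ (-ν-2)))) r := by
  have hZ : 0 < 1 + a * r ^ 2 := by positivity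
  have d1 : HasDerivAt (fun x => 1 + a * x ^ 2) (a * (2 * r)) r := by
    have := ((hasDerivAt_pow 2 r).const_mul a).const_add 1
    simpa using this
  refine (((hasDerivAt_pow (k+1) r).mul (d1.rpow_const (p := -ν-1) (Or.inl hZ.ne'))).const_mul
    (-(2 * ν * γ * a))).congr_deriv ?_
  have e1 : (1 + a * r ^ 2) ^ (-ν-1) = (1 + a * r ^ 2) ^ (-ν-2) * (1 + a * r ^ 2) := by
    rw [← rpow_add_one hZ.ne']; congr 1; ring
  have e2 : (1 + a * r ^ 2) ^ (-ν-1-1) = (1 + a * r ^ 2) ^ (-ν-2) := by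
    congr 1; ring
  rw [e2, e1]
  push_cast
  rw [hk]
  ring

namespace Bump
variable {k : ℕ} {ν lam γ a ρ : ℝ} {u u' : ℝ → ℝ}

lemma γa (h : Bump k ν lam γ a ρ u u') : γ ^ (2/ν) = 4 * ν * (ν+1) * a := by
  have := h.νpos
  rw [h.adef]; field_simp

lemma U_pow (h : Bump k ν lam γ a ρ u u') (r : ℝ) :
    (γ * (1 + a * r ^ 2) ^ (-ν)) ^ (2/ν) * (γ * (1 + a * r ^ 2) ^ (-ν)) =
      4 * ν * (ν + 1) * a * γ * (1 + a * r ^ 2) ^ (-ν-2) := by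
  have hν := h.νpos
  have ha := h.apos
  have hγ := h.γpos
  have hZ : 0 < 1 + a * r ^ 2 := by positivity
  rw [mul_rpow hγ.le (by positivity), h.γa, ← rpow_mul hZ.le]
  rw [show -ν * (2/ν) = -2 by field_simp, show -ν - 2 = -2 + -ν by ring, rpow_add hZ (-2) (-ν)]
  ring

lemma rpk (h : Bump k ν lam γ a ρ u u') {r : ℝ} (_hr : 0 < r) : r ^ k = r ^ (2*ν+1) := by
  rw [← h.kν, rpow_natCast]

lemma rpk1 (h : Bump k ν lam γ a ρ u u') {r : ℝ} (_hr : 0 < r) : r ^ (k+1) = r ^ (2*ν+2) := by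
  rw [← rpow_natCast]; push_cast; rw [h.kν]; congr 1; ring

lemma WU_eq (h : Bump k ν lam γ a ρ u u') {r : ℝ} (hr : 0 < r) :
    γ * a * (r ^ (k+1) * (1 + a * r ^ 2) ^ (-ν-1)) =
      γ * a ^ (-ν) * (a * r^2 / (1 + a * r^2)) ^ (ν+1) := by
  have ha := h.apos
  have hZ : 0 < 1 + a * r ^ 2 := by positivity
  rw [div_rpow (by positivity) hZ.le, mul_rpow ha.le (by positivity), h.rpk1 hr,
    show -ν-1 = -(ν+1) by ring, rpow_neg hZ.le, ← rpow_natCast, ← rpow_mul hr.le]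
  rw [rpow_add ha ν 1, rpow_neg ha.le, rpow_one]
  have := rpow_pos_of_pos ha ν
  have := rpow_pos_of_pos hZ (ν+1)
  push_cast
  rw [show 2 * (ν+1) = 2*ν+2 by ring]
  field_simp

lemma nl_le (h : Bump k ν lam γ a ρ u u') {r : ℝ} (hr : r ∈ Ico 0 ρ) :
    |u r| ^ (2/ν) * u r ≤ 4 * ν * (ν + 1) * a * γ * (1 + a * r ^ 2) ^ (-ν-2) := by
  have hp := h.pos r hr
  have hu := h.upper ⟨hr.1, hr.2.le⟩
  have hν := h.νpos
  rw [← h.U_pow, abs_of_pos hp]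
  have := rpow_le_rpow hp.le hu (by positivity : 0 ≤ 2/ν)
  exact mul_le_mul this hu hp.le (by have := hp.trans_le hu; positivity)

lemma cU (ha : 0 < a) : Continuous (fun x : ℝ => (1 + a * x ^ 2) ^ (-ν)) :=
  Continuous.rpow_const (by fun_prop) (fun x => Or.inl (by positivity))

lemma lower' (h : Bump k ν lam γ a ρ u u') {r : ℝ} (hr : r ∈ Ioc 0 ρ) :
    -(2 * ν * γ * a) * r * (1 + a * r ^ 2) ^ (-ν-1) - lam * γ / (2*(ν+1)) * r ≤ u' r := by
  have hν := h.νpos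
  have ha := h.apos
  have hr1 : r < 1 := lt_of_le_of_lt hr.2 h.ρ1
  have hsub : Icc 0 r ⊆ Icc 0 1 := Icc_subset_Icc_right hr1.le
  have := cmp_le (f := fun x => -(2 * ν * γ * a) * (x ^ (k+1) * (1 + a * x ^ 2) ^ (-ν-1))
        - lam * γ / (2*(ν+1)) * x^(k+1))
    (f' := fun r => -(r ^ k * (4 * ν * (ν + 1) * a * γ * (1 + a * r ^ 2) ^ (-ν-2)))
        - lam * γ * r ^ k) hr.1.le
    (by
      have : Continuous (fun x : ℝ => (1 + a * x ^ 2) ^ (-ν-1)) :=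
        Continuous.rpow_const (by fun_prop) (fun x => Or.inl (by positivity))
      fun_prop)
    (h.sol.cW.mono hsub) (by
      intro x hx
      refine ((bubbleW k γ a ν h.kν ha hx.1.ne').sub
        ((hasDerivAt_pow (k+1) x).const_mul (lam * γ / (2*(ν+1))))).congr_deriv ?_
      push_cast
      rw [h.kν]
      field_simp
      ring)
    (fun x hx => h.sol.hW ⟨hx.1, hx.2.trans hr1⟩) (by
      intro x hx
      have hx2 := hx.2.trans_le hr.2
      have h1 := h.nl_le ⟨hx.1.le, hx2⟩
      have h2 := h.le_γ ⟨hx.1.le, hx2.le⟩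
      have hl := h.lpos
      have h3 : (|u x| ^ (2/ν) + lam) * u x ≤
          4 * ν * (ν + 1) * a * γ * (1 + a * x ^ 2) ^ (-ν-2) + lam * γ := by nlinarith
      have := mul_le_mul_of_nonneg_left h3 (pow_pos hx.1 k).le
      linarith)
  simp only [zero_pow h.k0, zero_pow (Nat.succ_ne_zero k)] at this
  have hrk : 0 < r ^ k := pow_pos hr.1 k
  refine le_of_mul_le_mul_left ?_ hrk
  rw [pow_succ] at this
  linarith

lemma lower (h : Bump k ν lam γ a ρ u u') {r : ℝ} (hr : r ∈ Icc 0 ρ) :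
    γ * (1 + a * r ^ 2) ^ (-ν) - lam * γ / (4*(ν+1)) * r^2 ≤ u r := by
  have hν := h.νpos
  have ha := h.apos
  have hr1 : r < 1 := lt_of_le_of_lt hr.2 h.ρ1
  have hsub : Icc 0 r ⊆ Icc 0 1 := Icc_subset_Icc_right hr1.le
  have := cmp_le (f := fun x => γ * (1 + a * x ^ 2) ^ (-ν) - lam * γ / (4*(ν+1)) * x^2)
    (f' := fun r => -(2 * ν * γ * a) * r * (1 + a * r ^ 2) ^ (-ν-1) - lam * γ / (2*(ν+1)) * r) hr.1
    (by
      have : Continuous (fun x : ℝ => (1 + a * x ^ 2) ^ (-ν)) := cU ha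
      fun_prop)
    (h.sol.cu.mono hsub) (by
      intro x hx
      refine ((bubbleU γ a ν ha x).sub
        ((hasDerivAt_pow 2 x).const_mul (lam * γ / (4*(ν+1))))).congr_deriv ?_
      push_cast
      field_simp
      ring)
    (fun x hx => h.sol.du x ⟨hx.1, hx.2.trans hr1⟩)
    (fun x hx => h.lower' ⟨hx.1, hx.2.le.trans hr.2⟩)
  simp only [h.u0] at this
  norm_num at this
  linarith

lemma b_upper (h : Bump k ν lam γ a ρ u u') :
    -(ρ ^ k * u' ρ) ≤ γ * a ^ (-ν) * (2 * ν + lam * ρ ^ 2 / 2) := by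
  have hν := h.νpos
  have ha := h.apos
  have hγ := h.γpos
  have hρ := h.ρ0
  have hsub : Icc 0 ρ ⊆ Icc 0 1 := Icc_subset_Icc_right h.ρ1.le
  have := cmp_le (f := fun x => -(2 * ν * γ * a) * (x ^ (k+1) * (1 + a * x ^ 2) ^ (-ν-1))
        - lam * (γ * a ^ (-ν)) * (x^2 / 2))
    (f' := fun r => -(r ^ k * (4 * ν * (ν + 1) * a * γ * (1 + a * r ^ 2) ^ (-ν-2)))
        - lam * (γ * a ^ (-ν)) * r) h.ρ0.le
    (by
      have : Continuous (fun x : ℝ => (1 + a * x ^ 2) ^ (-ν-1)) :=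
        Continuous.rpow_const (by fun_prop) (fun x => Or.inl (by positivity))
      fun_prop)
    (h.sol.cW.mono hsub) (by
      intro x hx
      refine ((bubbleW k γ a ν h.kν ha hx.1.ne').sub
        (((hasDerivAt_pow 2 x).div_const 2).const_mul (lam * (γ * a ^ (-ν))))).congr_deriv ?_
      push_cast
      ring)
    (fun x hx => h.sol.hW ⟨hx.1, hx.2.trans h.ρ1⟩) (by
      intro x hx
      have h1 := h.nl_le ⟨hx.1.le, hx.2⟩
      have h2 := h.upper ⟨hx.1.le, hx.2.le⟩
      have hl := h.lpos
      have hx0 := hx.1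
      have h4 : x ^ k * (1 + a * x ^ 2) ^ (-ν) ≤ a ^ (-ν) * x := by
        have : (1 + a * x ^ 2) ^ (-ν) ≤ (a * x ^ 2) ^ (-ν) :=
          rpow_le_rpow_of_nonpos (by positivity) (by linarith) (by linarith)
        calc _ ≤ x ^ k * (a * x ^ 2) ^ (-ν) := by gcongr
          _ = _ := by
            rw [h.rpk hx0, mul_rpow ha.le (by positivity), ← rpow_natCast x 2, ← rpow_mul hx0.le]
            rw [show ((2:ℕ):ℝ) * (-ν) = -(2*ν) by push_cast; ring, rpow_neg hx0.le,
              rpow_add hx0, rpow_one]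
            have := rpow_pos_of_pos hx0 (2*ν)
            field_simp
      have hxk := pow_pos hx.1 k
      have h5 : x ^ k * (lam * u x) ≤ lam * (γ * a ^ (-ν)) * x := by
        calc _ ≤ x ^ k * (lam * (γ * (1 + a * x ^ 2) ^ (-ν))) := by gcongr
          _ = lam * γ * (x ^ k * (1 + a * x ^ 2) ^ (-ν)) := by ring
          _ ≤ lam * γ * (a ^ (-ν) * x) := by gcongr
          _ = _ := by ring
      have := mul_le_mul_of_nonneg_left h1 hxk.le
      linarith)
  simp only [zero_pow h.k0, zero_pow (Nat.succ_ne_zero k)] at this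
  have e := h.WU_eq hρ
  have h6 : (a * ρ^2 / (1 + a * ρ^2)) ^ (ν+1) ≤ 1 := by
    apply rpow_le_one (by positivity) _ (by positivity)
    rw [div_le_one (by positivity)]; linarith
  have h7 : γ * a ^ (-ν) * (a * ρ^2 / (1 + a * ρ^2)) ^ (ν+1) ≤ γ * a ^ (-ν) * 1 :=
    mul_le_mul_of_nonneg_left h6 (by positivity)
  rw [← e] at h7
  have h8 := mul_le_mul_of_nonneg_left h7 (by positivity : 0 ≤ 2 * ν)
  norm_num at this
  linarith

lemma core (h : Bump k ν lam γ a ρ u u') {X δ : ℝ} (hX : 0 < X) (hδ : δ < 1)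
    (hXδ : lam * X * (1 + X) ^ ν ≤ 4 * (ν + 1) * a * δ) :
    √(X / a) ≤ ρ ∧ ∀ s ∈ Icc 0 √(X/a), (1 - δ) * (γ * (1 + a * s ^ 2) ^ (-ν)) ≤ u s := by
  have hν := h.νpos
  have ha := h.apos
  have hγ := h.γpos
  have hl := h.lpos
  have key : ∀ s ∈ Icc 0 √(X/a), lam * γ / (4*(ν+1)) * s^2 ≤ δ * (γ * (1 + a * s ^ 2) ^ (-ν)) := by
    intro s hs
    have h1 : s ^ 2 ≤ X / a := by
      rw [← Real.sq_sqrt (by positivity : 0 ≤ X / a)]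
      exact pow_le_pow_left₀ hs.1 hs.2 2
    have h2 : a * s ^ 2 ≤ X := by rw [le_div_iff₀ ha] at h1; linarith
    have hδ0 : 0 < δ := by
      have : 0 < lam * X * (1 + X) ^ ν := by positivity
      by_contra hc
      push Not at hc
      have : 4 * (ν + 1) * a * δ ≤ 0 := mul_nonpos_of_nonneg_of_nonpos (by positivity) hc
      linarith
    have h3 : (1 + X) ^ (-ν) ≤ (1 + a * s ^ 2) ^ (-ν) :=
      rpow_le_rpow_of_nonpos (by positivity) (by linarith) (by linarith)
    have h4 : lam / (4 * (ν+1)) * (X / a) ≤ δ * (1 + X) ^ (-ν) := by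
      rw [rpow_neg (by positivity)]
      have := rpow_pos_of_pos (by positivity : 0 < 1 + X) ν
      rw [← div_eq_mul_inv, le_div_iff₀ this, div_mul_div_comm, div_mul_eq_mul_div,
        div_le_iff₀ (by positivity)]
      linarith
    calc lam * γ / (4*(ν+1)) * s^2 = γ * (lam / (4 * (ν+1)) * s^2) := by ring
      _ ≤ γ * (lam / (4 * (ν+1)) * (X / a)) := by gcongr
      _ ≤ γ * (δ * (1 + X) ^ (-ν)) := by gcongr
      _ ≤ γ * (δ * (1 + a * s ^ 2) ^ (-ν)) := by gcongr
      _ = _ := by ring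
  have hρ : √(X / a) ≤ ρ := by
    by_contra hc
    push Not at hc
    have h1 := key ρ ⟨h.ρ0.le, hc.le⟩
    have h2 := h.lower ⟨h.ρ0.le, le_rfl⟩
    rw [h.uρ] at h2
    have h3 : 0 < (1 - δ) * (γ * (1 + a * ρ ^ 2) ^ (-ν)) := by
      have : 0 < 1 - δ := by linarith
      positivity
    linarith
  refine ⟨hρ, fun s hs => ?_⟩
  have h1 := key s hs
  have h2 := h.lower ⟨hs.1, hs.2.trans hρ⟩
  linarith

lemma b_lower (h : Bump k ν lam γ a ρ u u') {X δ : ℝ} (hX : 0 < X) (hδ : δ < 1)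
    (hXδ : lam * X * (1 + X) ^ ν ≤ 4 * (ν + 1) * a * δ) :
    (1 - δ) ^ (2/ν) * (1 - δ) * (2 * ν * (γ * a ^ (-ν) * (X / (1 + X)) ^ (ν+1)))
      ≤ -(ρ ^ k * u' ρ) := by
  have hν := h.νpos
  have ha := h.apos
  have hγ := h.γpos
  have hl := h.lpos
  obtain ⟨h1, h2⟩ := h.core hX hδ hXδ
  set R := √(X / a) with hR
  have hR0 : 0 < R := Real.sqrt_pos.2 (by positivity)
  have hR1 : R < 1 := h1.trans_lt h.ρ1
  have hδ' : 0 < 1 - δ := by linarith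
  have hsub : Icc 0 R ⊆ Icc 0 1 := Icc_subset_Icc_right hR1.le
  have c1 := cmp_le (g := fun x => (1 - δ) ^ (2/ν) * (1 - δ) *
        (-(2 * ν * γ * a) * (x ^ (k+1) * (1 + a * x ^ 2) ^ (-ν-1))))
    (g' := fun r => (1 - δ) ^ (2/ν) * (1 - δ) *
        (-(r ^ k * (4 * ν * (ν + 1) * a * γ * (1 + a * r ^ 2) ^ (-ν-2))))) hR0.le
    (h.sol.cW.mono hsub)
    (by
      have : Continuous (fun x : ℝ => (1 + a * x ^ 2) ^ (-ν-1)) :=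
        Continuous.rpow_const (by fun_prop) (fun x => Or.inl (by positivity))
      fun_prop)
    (fun x hx => h.sol.hW ⟨hx.1, hx.2.trans hR1⟩)
    (fun x hx => (bubbleW k γ a ν h.kν ha hx.1.ne').const_mul _) (by
      intro x hx
      have hp := h.pos x ⟨hx.1.le, hx.2.trans_le h1⟩
      have hu := h2 x ⟨hx.1.le, hx.2.le⟩
      have hU : 0 < γ * (1 + a * x ^ 2) ^ (-ν) := by positivity
      rw [← h.U_pow, abs_of_pos hp]
      have e := rpow_le_rpow (by positivity) hu (by positivity : 0 ≤ 2/ν)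
      rw [mul_rpow hδ'.le hU.le] at e
      have e2 := mul_le_mul e hu (by positivity) (by positivity)
      have e3 : 0 < lam * u x := by positivity
      have := mul_le_mul_of_nonneg_left e2 (pow_pos hx.1 k).le
      have := mul_pos (pow_pos hx.1 k) e3
      nlinarith)
  simp only [zero_pow h.k0, zero_pow (Nat.succ_ne_zero k)] at c1
  have c2 := cmp_le (g := fun _ => 0) (g' := fun _ => 0) h1
    (h.sol.cW.mono (Icc_subset_Icc hR0.le h.ρ1.le)) continuousOn_const
    (fun x hx => h.sol.hW ⟨hR0.trans hx.1, hx.2.trans h.ρ1⟩) (fun x hx => hasDerivAt_const x 0) (by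
      intro x hx
      have hx0 := hR0.trans hx.1
      have hp := h.pos x ⟨hx0.le, hx.2⟩
      have : 0 < x ^ k * ((|u x| ^ (2 / ν) + lam) * u x) := by positivity
      linarith)
  have e := h.WU_eq hR0
  have hR2 : a * R ^ 2 = X := by
    rw [hR, Real.sq_sqrt (by positivity)]; field_simp
  rw [hR2] at e c1
  rw [← e]
  norm_num at c1
  nlinarith

lemma poh (h : Bump k ν lam γ a ρ u u') {x : ℝ} (hx : x ∈ Ioo 0 ρ) :
    HasDerivAt (fun r => ν * (r ^ k * u' r) * u r + r ^ (k+1) *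
      (u' r ^ 2 / 2 + u r ^ (2/ν+2) / (2/ν+2) + lam * u r ^ 2 / 2))
      (lam * (x ^ k * u x ^ 2)) x := by
  have hν := h.νpos
  have hx1 : x ∈ Ioo (0:ℝ) 1 := ⟨hx.1, hx.2.trans h.ρ1⟩
  have hp := h.pos x ⟨hx.1.le, hx.2⟩
  have hx0 : x ≠ 0 := hx.1.ne'
  have d1 := h.sol.du x hx1
  have d2 := h.sol.du' x hx1
  have d3 := h.sol.hW hx1
  have d4 := hasDerivAt_pow' (k+1) hx0
  have d5 := d1.rpow_const (p := 2/ν+2) (Or.inl hp.ne')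
  have d6 := ((d3.const_mul ν).mul d1).add (d4.mul ((((d2.fun_pow 2).div_const 2).add
    (d5.div_const (2/ν+2))).add (((d1.fun_pow 2).const_mul lam).div_const 2)))
  refine HasDerivAt.congr_deriv d6 ?_
  have e1 : u x ^ (2/ν+2-1) = u x ^ (2/ν) * u x := by
    rw [show 2/ν+2-1 = 2/ν + 1 by ring, rpow_add hp, rpow_one]
  have e2 : u x ^ (2/ν+2) = u x ^ (2/ν) * u x ^ 2 := by
    rw [rpow_add hp]; norm_num
  simp only [Pi.add_apply]
  rw [e1, e2, abs_of_pos hp]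
  have hk := h.kν
  push_cast
  rw [hk]
  generalize u x ^ (2/ν) = Y
  field_simp
  ring

lemma poh_cont (h : Bump k ν lam γ a ρ u u') :
    ContinuousOn (fun r => ν * (r ^ k * u' r) * u r + r ^ (k+1) *
      (u' r ^ 2 / 2 + u r ^ (2/ν+2) / (2/ν+2) + lam * u r ^ 2 / 2)) (Icc 0 1) := by
  have hcu := h.sol.cu
  have hcu' := h.sol.cu'
  have hν := h.νpos
  have h3 : ContinuousOn (fun r => u r ^ (2/ν+2)) (Icc 0 1) :=
        hcu.rpow_const (fun x _ => Or.inr (by positivity))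
  fun_prop

lemma poh_end (h : Bump k ν lam γ a ρ u u') :
    ν * (ρ ^ k * u' ρ) * u ρ + ρ ^ (k+1) *
      (u' ρ ^ 2 / 2 + u ρ ^ (2/ν+2) / (2/ν+2) + lam * u ρ ^ 2 / 2) =
      (-(ρ ^ k * u' ρ)) ^ 2 * ρ ^ (-(2*ν)) / 2 := by
  have hν := h.νpos
  have hρ := h.ρ0
  rw [h.uρ, zero_rpow (by positivity)]
  have e : ρ ^ (k+1) = ρ ^ k * ρ ^ k * ρ ^ (-(2*ν)) := by
    rw [h.rpk1 hρ, h.rpk hρ, ← rpow_add hρ, ← rpow_add hρ]; congr 1; ring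
  rw [e]; ring

lemma G_der (h : Bump k ν lam γ a ρ u u') {g : ℝ → ℝ}
    (hg : ∀ t > 0, HasDerivAt g (t ^ k * (1 + t^2) ^ (-(2*ν))) t) {r : ℝ} (hr : 0 < r) :
    HasDerivAt (fun x => γ ^ 2 * a ^ (-(ν+1)) * g (√a * x))
      (r ^ k * (γ * (1 + a * r ^ 2) ^ (-ν)) ^ 2) r := by
  have ha := h.apos
  have hZ : 0 < 1 + a * r ^ 2 := by positivity
  have hs : 0 < √a := Real.sqrt_pos.2 ha
  have d := (hg (√a * r) (by positivity)).comp r ((hasDerivAt_id r).const_mul √a)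
  refine (d.const_mul (γ ^ 2 * a ^ (-(ν+1)))).congr_deriv ?_
  have e1 : (√a * r) ^ 2 = a * r ^ 2 := by rw [mul_pow, Real.sq_sqrt ha.le]
  have e2 : (√a) ^ k * √a = a ^ (ν+1) := by
    rw [← pow_succ, h.rpk1 hs, Real.sqrt_eq_rpow, ← rpow_mul ha.le]; congr 1; ring
  have e3 : (1 + a * r ^ 2) ^ (-(2*ν)) = ((1 + a * r ^ 2) ^ (-ν)) ^ 2 := by
    rw [← rpow_natCast ((1 + a * r ^ 2) ^ (-ν)) 2, ← rpow_mul hZ.le]; congr 1; push_cast; ring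
  have e4 : a ^ (-(ν+1)) * a ^ (ν+1) = 1 := by rw [← rpow_add ha]; simp
  rw [e1, e3, mul_pow √a r k]
  calc _ = (a ^ (-(ν+1)) * (√a ^ k * √a)) * (r ^ k * (γ * (1 + a * r ^ 2) ^ (-ν)) ^ 2) := by ring
    _ = _ := by rw [e2, e4, one_mul]

lemma coef (h : Bump k ν lam γ a ρ u u') :
    γ ^ 2 * a ^ (-(ν+1)) = (γ * a ^ (-ν)) ^ 2 * a ^ (ν-1) := by
  have ha := h.apos
  rw [mul_pow, mul_assoc, ← rpow_natCast (a ^ (-ν)), ← rpow_mul ha.le, ← rpow_add ha]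
  congr 2; push_cast; ring

lemma poh_upper (h : Bump k ν lam γ a ρ u u') {g : ℝ → ℝ} (hgc : Continuous g) (hg0 : g 0 = 0)
    (hg : ∀ t > 0, HasDerivAt g (t ^ k * (1 + t^2) ^ (-(2*ν))) t) :
    (-(ρ ^ k * u' ρ)) ^ 2 * ρ ^ (-(2*ν)) ≤
      2 * lam * (γ * a ^ (-ν)) ^ 2 * a ^ (ν-1) * g (√a * ρ) := by
  have hsub : Icc 0 ρ ⊆ Icc 0 1 := Icc_subset_Icc_right h.ρ1.le
  have := cmp_le (g := fun x => lam * (γ ^ 2 * a ^ (-(ν+1)) * g (√a * x)))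
    (g' := fun r => lam * (r ^ k * (γ * (1 + a * r ^ 2) ^ (-ν)) ^ 2)) h.ρ0.le (h.poh_cont.mono hsub)
    (by fun_prop) (fun x hx => h.poh hx) (fun x hx => (h.G_der hg hx.1).const_mul _) (by
      intro x hx
      have hp := h.pos x ⟨hx.1.le, hx.2⟩
      have := h.upper ⟨hx.1.le, hx.2.le⟩
      have hl := h.lpos
      have hx0 := hx.1
      gcongr)
  rw [h.poh_end] at this
  simp only [zero_pow h.k0, zero_pow (Nat.succ_ne_zero k), mul_zero, hg0, h.coef] at this
  linarith

lemma poh_lower (h : Bump k ν lam γ a ρ u u') {g : ℝ → ℝ} (hgc : Continuous g) (hg0 : g 0 = 0)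
    (hg : ∀ t > 0, HasDerivAt g (t ^ k * (1 + t^2) ^ (-(2*ν))) t)
    {X δ : ℝ} (hX : 0 < X) (hδ : δ < 1)
    (hXδ : lam * X * (1 + X) ^ ν ≤ 4 * (ν + 1) * a * δ) :
    (1 - δ) ^ 2 * (2 * lam * (γ * a ^ (-ν)) ^ 2 * a ^ (ν-1) * g (√X)) ≤
    (-(ρ ^ k * u' ρ)) ^ 2 * ρ ^ (-(2*ν)) := by
  have ha := h.apos
  have hγ := h.γpos
  have hl := h.lpos
  obtain ⟨h1, h2⟩ := h.core hX hδ hXδ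
  have hRa : √a * √(X / a) = √X := by
    rw [← Real.sqrt_mul ha.le]; congr 1; field_simp
  set R := √(X / a) with hR
  have hR0 : 0 < R := Real.sqrt_pos.2 (by positivity)
  have hR1 : R < 1 := h1.trans_lt h.ρ1
  have hδ' : 0 < 1 - δ := by linarith
  have hsub : Icc 0 R ⊆ Icc 0 1 := Icc_subset_Icc_right hR1.le
  have c1 := cmp_le (f := fun x => (1 - δ) ^ 2 * (lam * (γ ^ 2 * a ^ (-(ν+1)) * g (√a * x))))
    (f' := fun r => (1 - δ) ^ 2 * (lam * (r ^ k * (γ * (1 + a * r ^ 2) ^ (-ν)) ^ 2))) hR0.le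
    (by fun_prop) (h.poh_cont.mono hsub)
    (fun x hx => ((h.G_der hg hx.1).const_mul _).const_mul _)
    (fun x hx => h.poh ⟨hx.1, hx.2.trans_le h1⟩) (by
      intro x hx
      have hu := h2 x ⟨hx.1.le, hx.2.le⟩
      have hU : 0 < γ * (1 + a * x ^ 2) ^ (-ν) := by positivity
      have hx0 := hx.1
      calc _ = lam * (x ^ k * ((1-δ) * (γ * (1 + a * x ^ 2) ^ (-ν))) ^ 2) := by ring
        _ ≤ _ := by gcongr)
  have c2 := cmp_le (f := fun _ => 0) (f' := fun _ => 0) h1 continuousOn_const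
    (h.poh_cont.mono (Icc_subset_Icc hR0.le h.ρ1.le))
     (fun x hx => hasDerivAt_const x 0)
    (fun x hx => h.poh ⟨hR0.trans hx.1, hx.2⟩) (by
      intro x hx
      have hx0 := hR0.trans hx.1
      positivity)
  rw [h.poh_end] at c2
  simp only [zero_pow h.k0, zero_pow (Nat.succ_ne_zero k), mul_zero, hg0, h.coef, hRa] at c1 c2
  linarith

end Bump


/-- The region beyond the first zero. -/
structure Outer (k : ℕ) (ν lam γ a ρ s M : ℝ) (u u' : ℝ → ℝ) : Prop where
  bump : Bump k ν lam γ a ρ u u'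
  ρs : ρ < s
  s1 : s < 1
  us : u s = -M
  u's : u' s = 0
  neg : ∀ r ∈ Ico ρ s, u' r < 0
  Mpos : 0 < M
  bound : ∀ r ∈ Icc ρ 1, |u r| ≤ M

lemma energy_anti {k : ℕ} {ν lam : ℝ} {u u' : ℝ → ℝ} (hν : 0 < ν)
    (h : LSol k (fun r => |u r| ^ (2 / ν) + lam) u u') {s r : ℝ} (hs : 0 ≤ s) (hsr : s ≤ r)
    (hr : r ≤ 1) :
    u' r ^ 2 / 2 + |u r| ^ (2/ν+2) / (2/ν+2) + lam * u r ^ 2 / 2 ≤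
    u' s ^ 2 / 2 + |u s| ^ (2/ν+2) / (2/ν+2) + lam * u s ^ 2 / 2 := by
  have hsub : Icc s r ⊆ Icc 0 1 := Icc_subset_Icc hs hr
  have hcu := h.cu.mono hsub
  have hcu' := h.cu'.mono hsub
  have hq : 0 < 2/ν + 2 := by positivity
  have hq0 : 0 < 2/ν := by positivity
  have := cmp_le (g := fun _ => 0) (g' := fun _ => 0)
    (f := fun r => u' r ^ 2 / 2 + |u r| ^ (2/ν+2) / (2/ν+2) + lam * u r ^ 2 / 2)
    (f' := fun r => - ((k:ℝ)/r) * u' r ^ 2) hsr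
    (by
      have h3 : ContinuousOn (fun r => |u r| ^ (2/ν+2)) (Icc s r) :=
        hcu.abs.rpow_const (fun x _ => Or.inr hq.le)
      fun_prop) continuousOn_const
    (by
      intro x hx
      have hx1 : x ∈ Ioo (0:ℝ) 1 := ⟨hs.trans_lt hx.1, hx.2.trans_le hr⟩
      have hx0 : x ≠ 0 := hx1.1.ne'
      have d1 := h.du x hx1
      have d2 := h.du' x hx1
      have d5 := (hasDerivAt_abs_rpow (u x) (p := 2/ν+2) (by linarith)).comp x d1
      have d6 := (((d2.fun_pow 2).div_const 2).add (d5.div_const (2/ν+2))).add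
        (((d1.fun_pow 2).const_mul lam).div_const 2)
      refine HasDerivAt.congr_deriv d6 ?_
      rw [show 2/ν+2-2 = 2/ν by ring]
      generalize |u x| ^ (2/ν) = Y
      push_cast
      field_simp
      ring)
    (fun x hx => hasDerivAt_const x 0) (by
      intro x hx
      have hx0 := hs.trans_lt hx.1
      have : 0 ≤ ((k:ℝ)/x) * u' x ^ 2 := by positivity
      linarith)
  linarith

lemma exists_outer {k : ℕ} {ν lam γ a ρ M : ℝ} {u u' : ℝ → ℝ} (h : Bump k ν lam γ a ρ u u')
    (hM : M = sSup ((fun s => |u s|) '' Icc ρ 1)) : ∃ s, Outer k ν lam γ a ρ s M u u' := by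
  have hν := h.νpos
  have hsub : Icc ρ 1 ⊆ Icc 0 1 := Icc_subset_Icc_left h.ρ0.le
  have hcu' := h.sol.cu'.mono hsub
  have hcu := h.sol.cu.mono hsub
  obtain ⟨c, hc, hc0⟩ := exists_hasDerivAt_eq_zero h.ρ1 hcu (by rw [h.uρ, h.u1])
    (fun x hx => h.sol.du x ⟨h.ρ0.trans hx.1, hx.2⟩)
  have hcomp : IsCompact (Icc ρ 1 ∩ u' ⁻¹' {0}) :=
    isCompact_Icc.of_isClosed_subset (hcu'.preimage_isClosed_of_isClosed isClosed_Icc isClosed_singleton)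
      inter_subset_left
  obtain ⟨s, ⟨hs, hs0⟩, hsl⟩ := hcomp.exists_isLeast ⟨c, ⟨hc.1.le, hc.2.le⟩, hc0⟩
  have hs0 : u' s = 0 := hs0
  have hsc : s ≤ c := hsl ⟨⟨hc.1.le, hc.2.le⟩, hc0⟩
  have hs1 : s < 1 := hsc.trans_lt hc.2
  have hρn := h.neg ⟨h.ρ0, le_rfl⟩
  have hρs : ρ < s := lt_of_le_of_ne hs.1 (by rintro rfl; linarith)
  have hneg : ∀ r ∈ Ico ρ s, u' r < 0 := by
    intro r hr
    by_contra hcon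
    push Not at hcon
    have hsub2 : Icc ρ r ⊆ Icc ρ 1 := Icc_subset_Icc_right (hr.2.le.trans hs1.le)
    obtain ⟨y, hy, hy0⟩ := intermediate_value_Icc hr.1 (hcu'.mono hsub2) (⟨hρn.le, hcon⟩ : (0:ℝ) ∈ Icc (u' ρ) (u' r))
    have := hsl ⟨hsub2 hy, hy0⟩
    linarith [hy.2, hr.2]
  have hanti : ∀ x y, ρ ≤ x → x < y → y ≤ s → u y < u x := by
    intro x y hx hxy hy
    have := cmp_lt (g := fun _ => 0) (g' := fun _ => 0) hxy
      (hcu.mono (Icc_subset_Icc hx (hy.trans hs1.le))) continuousOn_const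
      (fun t ht => h.sol.du t ⟨h.ρ0.trans_le (hx.trans ht.1.le), (ht.2.trans_le hy).trans hs1⟩)
      (fun t ht => hasDerivAt_const t 0)
      (fun t ht => hneg t ⟨hx.trans ht.1.le, ht.2.trans_le hy⟩)
    linarith
  have husneg : u s < 0 := by
    have := hanti ρ s le_rfl hρs le_rfl
    rwa [h.uρ] at this
  have hbd : ∀ r ∈ Icc ρ 1, |u r| ≤ -u s := by
    intro r hr
    rcases le_or_gt r s with hrs | hrs
    · have h1 : u s ≤ u r := by
        rcases eq_or_lt_of_le hrs with h0 | h0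
        · rw [h0]
        · exact (hanti r s hr.1 h0 le_rfl).le
      have h2 : u r ≤ 0 := by
        rcases eq_or_lt_of_le hr.1 with h0 | h0
        · rw [← h0, h.uρ]
        · have := hanti ρ r le_rfl h0 hrs
          rw [h.uρ] at this
          exact this.le
      rw [abs_of_nonpos h2]; linarith
    · have hE := energy_anti hν h.sol (h.ρ0.trans hρs).le hrs.le hr.2
      rw [hs0] at hE
      by_contra hcon
      push Not at hcon
      rw [← abs_of_neg husneg] at hcon
      have hq : 0 < 2/ν+2 := by positivity
      have h1 := rpow_lt_rpow (abs_nonneg _) hcon hq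
      have h2 : u s ^ 2 < u r ^ 2 := sq_lt_sq.2 hcon
      have h3 := div_lt_div_of_pos_right h1 hq
      have hl := h.lpos
      have := mul_lt_mul_of_pos_left h2 hl
      nlinarith [sq_nonneg (u' r)]
  have hMeq : M = -u s := by
    rw [hM]
    apply IsGreatest.csSup_eq
    refine ⟨⟨s, hs, ?_⟩, ?_⟩
    · exact abs_of_neg husneg
    · rintro _ ⟨r, hr, rfl⟩
      exact hbd r hr
  refine ⟨s, h, hρs, hs1, by linarith, hs0, hneg, by linarith, ?_⟩
  rw [hMeq]; exact hbd

namespace Outer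
variable {k : ℕ} {ν lam γ a ρ s M : ℝ} {u u' : ℝ → ℝ}

lemma s0 (h : Outer k ν lam γ a ρ s M u u') : 0 < s := h.bump.ρ0.trans h.ρs

lemma anti (h : Outer k ν lam γ a ρ s M u u') {x y : ℝ} (hx : ρ ≤ x) (hxy : x ≤ y) (hy : y ≤ s) :
    u y ≤ u x := by
  have := cmp_le (g := fun _ => 0) (g' := fun _ => 0) hxy
      (h.bump.sol.cu.mono (Icc_subset_Icc (h.bump.ρ0.le.trans hx) (hy.trans h.s1.le))) continuousOn_const
      (fun t ht => h.bump.sol.du t ⟨h.bump.ρ0.trans_le (hx.trans ht.1.le), (ht.2.trans_le hy).trans h.s1⟩)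
      (fun t ht => hasDerivAt_const t 0)
      (fun t ht => (h.neg t ⟨hx.trans ht.1.le, ht.2.trans_le hy⟩).le)
  linarith

lemma nonpos (h : Outer k ν lam γ a ρ s M u u') {x : ℝ} (hx : x ∈ Icc ρ s) : u x ≤ 0 := by
  rw [← h.bump.uρ]; exact h.anti le_rfl hx.1 hx.2

lemma ltz (h : Outer k ν lam γ a ρ s M u u') {x : ℝ} (hx : x ∈ Ioc ρ s) : u x < 0 := by
  have := cmp_lt (g := fun _ => 0) (g' := fun _ => 0) hx.1
      (h.bump.sol.cu.mono (Icc_subset_Icc h.bump.ρ0.le (hx.2.trans h.s1.le))) continuousOn_const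
      (fun t ht => h.bump.sol.du t ⟨h.bump.ρ0.trans ht.1, (ht.2.trans_le hx.2).trans h.s1⟩)
      (fun t ht => hasDerivAt_const t 0)
      (fun t ht => h.neg t ⟨ht.1.le, ht.2.trans_le hx.2⟩)
  rw [h.bump.uρ] at this
  linarith

lemma Wmono (h : Outer k ν lam γ a ρ s M u u') {x y : ℝ} (hx : ρ ≤ x) (hxy : x ≤ y) (hy : y ≤ s) :
    x ^ k * u' x ≤ y ^ k * u' y := by
  have := cmp_le (f := fun _ => 0) (f' := fun _ => 0) hxy continuousOn_const
      (h.bump.sol.cW.mono (Icc_subset_Icc (h.bump.ρ0.le.trans hx) (hy.trans h.s1.le)))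
      (fun t ht => hasDerivAt_const t 0)
      (fun t ht => h.bump.sol.hW ⟨h.bump.ρ0.trans_le (hx.trans ht.1.le), (ht.2.trans_le hy).trans h.s1⟩)
      (by
        intro t ht
        have := h.nonpos ⟨hx.trans ht.1.le, ht.2.le.trans hy⟩
        have hl := h.bump.lpos
        have ht0 := h.bump.ρ0.trans_le (hx.trans ht.1.le)
        have : 0 ≤ t ^ k * ((|u t| ^ (2 / ν) + lam) * (- u t)) := by
          have : 0 ≤ - u t := by linarith
          positivity
        linarith)
  linarith

lemma bpos (h : Outer k ν lam γ a ρ s M u u') : 0 < -(ρ ^ k * u' ρ) := by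
  have h1 := h.neg ρ ⟨le_rfl, h.ρs⟩
  have h2 := pow_pos h.bump.ρ0 k
  nlinarith

lemma der_pow (hν : 0 < ν) {r : ℝ} (hr : 0 < r) (hk : (k:ℝ) = 2 * ν + 1) (c : ℝ) :
    HasDerivAt (fun x => c * (x ^ (-(2*ν)) / (2*ν))) (-c / r ^ k) r := by
  refine ((((hasDerivAt_id r).rpow_const (p := -(2*ν)) (Or.inl hr.ne')).div_const (2*ν)).const_mul c).congr_deriv ?_
  simp only [id]
  rw [show -(2*ν)-1 = -(k:ℝ) by rw [hk]; ring, rpow_neg hr.le, rpow_natCast]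
  field_simp

lemma cpow {x y : ℝ} (hx : 0 < x) (c : ℝ) :
    ContinuousOn (fun x : ℝ => c * (x ^ (-(2*ν)) / (2*ν))) (Icc x y) := by
  have : ContinuousOn (fun x : ℝ => x ^ (-(2*ν))) (Icc x y) :=
    continuousOn_id.rpow_const (fun t ht => Or.inl (hx.trans_le ht.1).ne')
  fun_prop

lemma M_le (h : Outer k ν lam γ a ρ s M u u') :
    M ≤ -(ρ ^ k * u' ρ) * (ρ ^ (-(2*ν)) / (2*ν)) := by
  have hν := h.bump.νpos
  have hs0 := h.s0
  have hb := h.bpos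
  set b := -(ρ ^ k * u' ρ) with hbdef
  have := cmp_le (f := fun x => b * (x ^ (-(2*ν)) / (2*ν))) (f' := fun r => -b / r ^ k)
    (g := u) (g' := u') h.ρs.le (cpow h.bump.ρ0 b)
    (h.bump.sol.cu.mono (Icc_subset_Icc h.bump.ρ0.le h.s1.le))
    (fun x hx => der_pow hν (h.bump.ρ0.trans hx.1) h.bump.kν b)
    (fun x hx => h.bump.sol.du x ⟨h.bump.ρ0.trans hx.1, hx.2.trans h.s1⟩) (by
      intro x hx
      have h1 := h.Wmono le_rfl hx.1.le hx.2.le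
      have hx0 := h.bump.ρ0.trans hx.1
      rw [div_le_iff₀ (by positivity)]
      linarith)
  simp only [h.us, h.bump.uρ] at this
  have h2 : 0 ≤ b * (s ^ (-(2*ν)) / (2*ν)) := by positivity
  linarith

lemma W_le (h : Outer k ν lam γ a ρ s M u u') {r : ℝ} (hr : r ∈ Icc ρ s) :
    r ^ k * u' r ≤ ρ ^ k * u' ρ + (M ^ (2/ν) + lam) * M * (r ^ (k+1) / (k+1)) := by
  have hν := h.bump.νpos
  have hl := h.bump.lpos
  have hM := h.Mpos
  have hρ := h.bump.ρ0
  have := cmp_le (g := fun x => (M ^ (2/ν) + lam) * M * (x ^ (k+1) / (k+1)))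
    (g' := fun x => (M ^ (2/ν) + lam) * M * x ^ k) hr.1
    (h.bump.sol.cW.mono (Icc_subset_Icc h.bump.ρ0.le (hr.2.trans h.s1.le))) (by fun_prop)
    (fun t ht => h.bump.sol.hW ⟨h.bump.ρ0.trans ht.1, (ht.2.trans_le hr.2).trans h.s1⟩)
    (by
      intro x hx
      refine (((hasDerivAt_pow (k+1) x).div_const ((k:ℝ)+1)).const_mul _).congr_deriv ?_
      push_cast
      have : (k:ℝ) + 1 ≠ 0 := by positivity
      field_simp
      try simp) (by
      intro t ht
      have h1 := h.nonpos ⟨ht.1.le, ht.2.le.trans hr.2⟩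
      have h2 := h.bound t ⟨ht.1.le, (ht.2.le.trans hr.2).trans h.s1.le⟩
      have ht0 := hρ.trans ht.1
      have h3 := rpow_le_rpow (abs_nonneg _) h2 (by positivity : 0 ≤ 2/ν)
      rw [abs_of_nonpos h1] at h2 h3 ⊢
      have h4 : (( -u t) ^ (2/ν) + lam) * (-u t) ≤ (M ^ (2/ν) + lam) * M :=
        mul_le_mul (by linarith) h2 (by linarith) (by positivity)
      have := mul_le_mul_of_nonneg_left h4 (pow_pos ht0 k).le
      linarith)
  have h5 : 0 ≤ (M ^ (2/ν) + lam) * M * (ρ ^ (k+1) / (k+1)) := by positivity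
  linarith

lemma O2 (h : Outer k ν lam γ a ρ s M u u') {K δ : ℝ} (hK : 1 ≤ K) (hδ : δ < 1)
    (hKδ : (M ^ (2/ν) + lam) * M * ((K * ρ) ^ (k+1) / (k+1)) ≤ δ * -(ρ ^ k * u' ρ)) :
    K * ρ ≤ s ∧ (1 - δ) * -(ρ ^ k * u' ρ) * (ρ ^ (-(2*ν)) / (2*ν) * (1 - K ^ (-(2*ν)))) ≤ -u (K * ρ) := by
  have hν := h.bump.νpos
  have hl := h.bump.lpos
  have hM := h.Mpos
  have hρ := h.bump.ρ0
  have hb := h.bpos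
  have hs0 := h.s0
  have hKρ : ρ ≤ K * ρ := le_mul_of_one_le_left hρ.le hK
  set b := -(ρ ^ k * u' ρ) with hbdef
  have key : ∀ r ∈ Icc ρ s, r ≤ K * ρ → r ^ k * u' r ≤ -((1 - δ) * b) := by
    intro r hr hrK
    have h1 := h.W_le hr
    have hr0 := hρ.trans_le hr.1
    have h2 : (M ^ (2/ν) + lam) * M * (r ^ (k+1) / (k+1)) ≤
      (M ^ (2/ν) + lam) * M * ((K * ρ) ^ (k+1) / (k+1)) := by gcongr
    linarith
  have hδ' : 0 < 1 - δ := by linarith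
  have h1 : K * ρ ≤ s := by
    by_contra hc
    push Not at hc
    have := key s ⟨h.ρs.le, le_rfl⟩ hc.le
    rw [h.u's] at this
    have : 0 < (1 - δ) * b := by positivity
    linarith
  refine ⟨h1, ?_⟩
  have := cmp_le (g := fun x => (1-δ) * b * (x ^ (-(2*ν)) / (2*ν))) (g' := fun r => -((1-δ) * b) / r ^ k)
    (f := u) (f' := u') hKρ
    (h.bump.sol.cu.mono (Icc_subset_Icc hρ.le (h1.trans h.s1.le))) (cpow hρ _)
    (fun x hx => h.bump.sol.du x ⟨hρ.trans hx.1, (hx.2.trans_le h1).trans h.s1⟩)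
    (fun x hx => der_pow hν (hρ.trans hx.1) h.bump.kν _)
     (by
      intro x hx
      have h1 := key x ⟨hx.1.le, hx.2.le.trans h1⟩ hx.2.le
      have hx0 := hρ.trans hx.1
      rw [le_div_iff₀ (by positivity)]
      linarith)
  simp only [h.bump.uρ] at this
  rw [mul_rpow (by linarith) hρ.le] at this
  linear_combination this

lemma O3 (h : Outer k ν lam γ a ρ s M u u') {c : ℝ} (hc : c ∈ Icc ρ s) :
    lam * (-u c) * ((s ^ (k+1) - c ^ (k+1)) / (k+1)) ≤ -(ρ ^ k * u' ρ) := by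
  have hν := h.bump.νpos
  have hl := h.bump.lpos
  have hρ := h.bump.ρ0
  have := cmp_le (f := fun x => lam * (-u c) * (x ^ (k+1) / (k+1)))
    (f' := fun x => lam * (-u c) * x ^ k) hc.2 (by fun_prop)
    (h.bump.sol.cW.mono (Icc_subset_Icc (hρ.le.trans hc.1) h.s1.le))
    (by
      intro x hx
      refine (((hasDerivAt_pow (k+1) x).div_const ((k:ℝ)+1)).const_mul _).congr_deriv ?_
      push_cast
      have : (k:ℝ) + 1 ≠ 0 := by positivity
      field_simp
      try simp)
    (fun t ht => h.bump.sol.hW ⟨hρ.trans_le (hc.1.trans ht.1.le), ht.2.trans h.s1⟩) (by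
      intro t ht
      have h1 := h.nonpos ⟨hc.1.trans ht.1.le, ht.2.le⟩
      have h2 := h.anti hc.1 ht.1.le ht.2.le
      have ht0 := hρ.trans_le (hc.1.trans ht.1.le)
      have h3 : 0 ≤ |u t| ^ (2/ν) := by positivity
      have h4 : lam * (-u c) ≤ (|u t| ^ (2/ν) + lam) * (-u t) := by nlinarith
      have := mul_le_mul_of_nonneg_left h4 (pow_pos ht0 k).le
      linarith)
  have h5 := h.Wmono le_rfl hc.1 hc.2
  simp only [h.u's] at this
  have e : lam * (-u c) * ((s ^ (k+1) - c ^ (k+1)) / (k+1)) =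
     lam * (-u c) * (s ^ (k+1) / (k+1)) - lam * (-u c) * (c ^ (k+1) / (k+1)) := by ring
  linarith

lemma near (h : Outer k ν lam γ a ρ s M u u') {c C : ℝ} (hc1 : c < 1)
    (hC : M ^ (2/ν) + lam ≤ C) (hCc : C * c ^ 2 ≤ 1) {r : ℝ} (hr : r ∈ Icc s c) : u r ≤ -M/2 := by
  have hν := h.bump.νpos
  have hl := h.bump.lpos
  have hM := h.Mpos
  have hs0 := h.s0
  have hC0 : 0 < C := lt_of_lt_of_le (by positivity) hC
  have der : ∀ t ∈ Icc s c, u' t ≤ C * M * t := by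
    intro t ht
    have ht0 := hs0.trans_le ht.1
    have := cmp_le (g := fun x => C * M * (x ^ (k+1) / (k+1)))
      (g' := fun x => C * M * x ^ k) ht.1
      (h.bump.sol.cW.mono (Icc_subset_Icc hs0.le (ht.2.trans hc1.le))) (by fun_prop)
      (fun t' ht' => h.bump.sol.hW ⟨hs0.trans ht'.1, (ht'.2.trans_le ht.2).trans hc1⟩)
      (by
        intro x hx
        refine (((hasDerivAt_pow (k+1) x).div_const ((k:ℝ)+1)).const_mul _).congr_deriv ?_
        push_cast
        have : (k:ℝ) + 1 ≠ 0 := by positivity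
        field_simp
        try simp) (by
        intro x hx
        have hx0 := hs0.trans hx.1
        have h2 := h.bound x ⟨(h.ρs.trans hx.1).le, (hx.2.le.trans ht.2).trans hc1.le⟩
        have h3 := rpow_le_rpow (abs_nonneg _) h2 (by positivity : 0 ≤ 2/ν)
        have h4 : (|u x| ^ (2/ν) + lam) * |u x| ≤ C * M :=
          mul_le_mul (by linarith) h2 (abs_nonneg _) hC0.le
        have h5 : -((|u x| ^ (2/ν) + lam) * u x) ≤ (|u x| ^ (2/ν) + lam) * |u x| := by
          have : 0 < |u x| ^ (2/ν) + lam := by positivity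
          nlinarith [neg_abs_le (u x)]
        have := mul_le_mul_of_nonneg_left (h5.trans h4) (pow_pos hx0 k).le
        linarith)
    simp only [h.u's] at this
    have h6 : 0 ≤ C * M * (s ^ (k+1) / (k+1)) := by positivity
    have h7 : t ^ k * u' t ≤ t ^ k * (C * M * (t / (k+1))) := by
      have e : C * M * (t ^ (k+1) / (k+1)) = t ^ k * (C * M * (t / (k+1))) := by rw [pow_succ]; ring
      rw [e] at this
      linarith
    have h8 := le_of_mul_le_mul_left h7 (pow_pos ht0 k)
    have h9 : t / (k+1) ≤ t := div_le_self ht0.le (by linarith [(Nat.cast_nonneg k : (0:ℝ) ≤ k)])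
    exact h8.trans (by gcongr)
  have := cmp_le (g := fun x => C * M * (x ^ 2 / 2)) (g' := fun x => C * M * x) hr.1
    (h.bump.sol.cu.mono (Icc_subset_Icc hs0.le (hr.2.trans hc1.le))) (by fun_prop)
    (fun t ht => h.bump.sol.du t ⟨hs0.trans ht.1, (ht.2.trans_le hr.2).trans hc1⟩)
    (by
      intro x hx
      refine (((hasDerivAt_pow 2 x).div_const 2).const_mul _).congr_deriv ?_
      push_cast
      ring)
    (fun t ht => der t ⟨ht.1.le, ht.2.le.trans hr.2⟩)
  simp only [h.us] at this
  have h1 : C * r ^ 2 ≤ 1 := by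
    refine le_trans ?_ hCc
    have := hs0.trans_le hr.1
    have := hr.2
    gcongr
  have h2 : 0 ≤ C * M * (s ^ 2 / 2) := by positivity
  nlinarith

lemma conv (h : Outer k ν lam γ a ρ s M u u') {μ : ℝ} (hμ : 0 < μ) {ψ ψ' : ℝ → ℝ}
    (hψ : LSol k (fun _ => μ) ψ ψ') {r : ℝ} (hr : r ∈ Icc s 1) :
    (u' r / M - ψ' r) ^ 2 + μ * (u r / M - ψ r) ^ 2 ≤
      rexp 1 * (ψ' s ^ 2 + μ * (1 + ψ s) ^ 2 + (|μ - lam| + M ^ (2/ν)) ^ 2) := by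
  have hν := h.bump.νpos
  have hl := h.bump.lpos
  have hM := h.Mpos
  have hs0 := h.s0
  set η := |μ - lam| + M ^ (2/ν) with hη
  have hsub : Icc s r ⊆ Icc 0 1 := Icc_subset_Icc hs0.le hr.2
  have c1 := h.bump.sol.cu.mono hsub
  have c2 := h.bump.sol.cu'.mono hsub
  have c3 := hψ.cu.mono hsub
  have c4 := hψ.cu'.mono hsub
  have := cmp_le (g := fun _ => 0) (g' := fun _ => 0)
    (f := fun r => rexp (-r) * ((u' r / M - ψ' r) ^ 2 + μ * (u r / M - ψ r) ^ 2 + η ^ 2))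
    (f' := fun r => rexp (-r) * (2 * (u' r / M - ψ' r) * (-((k:ℝ)/r) * (u' r / M - ψ' r)
       + (μ - lam - |u r| ^ (2/ν)) * (u r / M)) -
       ((u' r / M - ψ' r) ^ 2 + μ * (u r / M - ψ r) ^ 2 + η ^ 2))) hr.1
    (by fun_prop) continuousOn_const (by
      intro x hx
      have hx1 : x ∈ Ioo (0:ℝ) 1 := ⟨hs0.trans hx.1, hx.2.trans_le hr.2⟩
      have d1 := ((h.bump.sol.du x hx1).div_const M).sub (hψ.du x hx1)
      have d2 := ((h.bump.sol.du' x hx1).div_const M).sub (hψ.du' x hx1)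
      have d3 := (hasDerivAt_neg x).exp
      have d4 := d3.mul (((d2.fun_pow 2).add ((d1.fun_pow 2).const_mul μ)).add_const (η^2))
      refine HasDerivAt.congr_deriv d4 ?_
      simp only [Pi.sub_apply, Pi.add_apply]
      push_cast
      ring) (fun x hx => hasDerivAt_const x 0) (by
      intro x hx
      have hx0 := hs0.trans hx.1
      have hb := h.bound x ⟨(h.ρs.trans hx.1).le, hx.2.le.trans hr.2⟩
      have h1 := rpow_le_rpow (abs_nonneg _) hb (by positivity : 0 ≤ 2/ν)
      have h2 : |u x / M| ≤ 1 := by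
        rw [abs_div, abs_of_pos hM, div_le_one hM]; exact hb
      have h3 : |(μ - lam - |u x| ^ (2/ν)) * (u x / M)| ≤ η := by
        rw [abs_mul]
        have h4 : |μ - lam - |u x| ^ (2/ν)| ≤ η := by
          refine (abs_sub _ _).trans ?_
          rw [abs_of_nonneg (by positivity : 0 ≤ |u x| ^ (2/ν))]
          linarith
        calc _ ≤ η * 1 := mul_le_mul h4 h2 (abs_nonneg _) ((abs_nonneg _).trans h4)
          _ = η := mul_one η
      generalize (μ - lam - |u x| ^ (2/ν)) * (u x / M) = e at h3
      have h5 : e ^ 2 ≤ η ^ 2 := sq_le_sq' (by linarith [neg_abs_le e]) (by linarith [le_abs_self e])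
      have h6 : 0 ≤ ((k:ℝ)/x) * (u' x / M - ψ' x) ^ 2 := by positivity
      apply mul_nonpos_of_nonneg_of_nonpos (exp_pos _).le
      nlinarith [sq_nonneg (u' x / M - ψ' x - e), mul_nonneg hμ.le (sq_nonneg (u x / M - ψ x))])
  simp only [h.us, h.u's] at this
  have e1 : (-M / M : ℝ) = -1 := by field_simp
  rw [e1] at this
  have h1 : (u' r / M - ψ' r) ^ 2 + μ * (u r / M - ψ r) ^ 2 + η ^ 2 ≤
      rexp r * (rexp (-s) * ((0 / M - ψ' s) ^ 2 + μ * (-1 - ψ s) ^ 2 + η ^ 2)) := by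
    rw [← div_le_iff₀' (exp_pos r), div_eq_inv_mul, ← Real.exp_neg]
    linarith
  rw [← mul_assoc, ← Real.exp_add] at h1
  have h2 : rexp (r + -s) ≤ rexp 1 := Real.exp_le_exp.2 (by linarith [hr.2])
  have h3 : 0 ≤ (0 / M - ψ' s) ^ 2 + μ * (-1 - ψ s) ^ 2 + η ^ 2 := by positivity
  have h4 := mul_le_mul_of_nonneg_right h2 h3
  have e2 : (0 / M - ψ' s) ^ 2 + μ * (-1 - ψ s) ^ 2 + η ^ 2 = ψ' s ^ 2 + μ * (1 + ψ s) ^ 2 + η ^ 2 := by ring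
  rw [e2] at h4 h1
  nlinarith [sq_nonneg η]

end Outer


lemma sign_Ioo {f : ℝ → ℝ} {α β : ℝ} (hf : ContinuousOn f (Ioo α β)) (h0 : ∀ x ∈ Ioo α β, f x ≠ 0) :
    (∀ x ∈ Ioo α β, 0 < f x) ∨ (∀ x ∈ Ioo α β, f x < 0) := by
  by_contra hc
  push Not at hc
  obtain ⟨⟨x, hx, hx'⟩, y, hy, hy'⟩ := hc
  obtain ⟨z, hz, hz'⟩ := isPreconnected_Ioo.intermediate_value hx hy hf (show (0:ℝ) ∈ Icc (f x) (f y) from ⟨hx', hy'⟩)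
  exact h0 z hz hz'

lemma LSol.smul {k : ℕ} {V f f' : ℝ → ℝ} (h : LSol k V f f') :
    LSol k V (fun x => - f x) (fun x => - f' x) where
  cu := h.cu.neg
  cu' := h.cu'.neg
  du r hr := (h.du r hr).fun_neg
  du' r hr := ((h.du' r hr).fun_neg).congr_deriv (by ring)

lemma LSol.omega {k : ℕ} {V V2 f f' g g' : ℝ → ℝ} (hf : LSol k V f f') (hg : LSol k V2 g g')
    {r : ℝ} (hr : r ∈ Ioo (0:ℝ) 1) :
    HasDerivAt (fun x => x ^ k * (f x * g' x - f' x * g x)) (r ^ k * (V r - V2 r) * (f r * g r)) r := by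
  have h1 := ((hf.du r hr).mul (hg.hW hr)).sub ((hf.hW hr).mul (hg.du r hr))
  have e : (fun x => x ^ k * (f x * g' x - f' x * g x)) =
     (f * fun x => x ^ k * g' x) - ((fun x => x ^ k * f' x) * g) := by
    ext x; simp only [Pi.sub_apply, Pi.mul_apply]; ring
  rw [e]
  refine h1.congr_deriv ?_
  ring

lemma LSol.cOmega {k : ℕ} {V V2 f f' g g' : ℝ → ℝ} (hf : LSol k V f f') (hg : LSol k V2 g g') :
    ContinuousOn (fun x => x ^ k * (f x * g' x - f' x * g x)) (Icc 0 1) := by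
  have := hf.cu
  have := hf.cu'
  have := hg.cu
  have := hg.cu'
  fun_prop

lemma LSol.end_sign {k : ℕ} {V f f' : ℝ → ℝ} (hf : LSol k V f f') {α β : ℝ} (hα : 0 < α) (hαβ : α < β)
    (hβ : β ≤ 1) (hp : ∀ x ∈ Ioo α β, 0 < f x) (h0 : f β = 0) : f' β ≤ 0 := by
  by_contra hc
  push Not at hc
  have hcont : ContinuousWithinAt f' (Icc α β) β :=
    (hf.cu'.mono (Icc_subset_Icc hα.le hβ)) β (right_mem_Icc.2 hαβ.le)
  have h1 : ∀ᶠ x in 𝓝[Icc α β] β, 0 < f' x := hcont.eventually_const_lt hc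
  have h2 : ∀ᶠ x in 𝓝[<] β, 0 < f' x := by
    rw [← nhdsWithin_Ico_eq_nhdsLT hαβ]
    exact h1.filter_mono (nhdsWithin_mono _ Ico_subset_Icc_self)
  obtain ⟨c, hc1, hc2⟩ := (mem_nhdsLT_iff_exists_Ioo_subset' hαβ).1 h2
  have hc1' : c < β := hc1
  set d := max c ((α+β)/2) with hd
  have hdβ : d < β := max_lt hc1' (by linarith)
  have hαd : α < d := lt_of_lt_of_le (by linarith) (le_max_right _ _)
  have := cmp_lt (f := fun _ => 0) (f' := fun _ => 0) hdβ continuousOn_const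
    (hf.cu.mono (Icc_subset_Icc (hα.trans hαd).le hβ)) (fun x _ => hasDerivAt_const x 0)
    (fun x hx => hf.du x ⟨(hα.trans hαd).trans hx.1, hx.2.trans_le hβ⟩)
    (fun x hx => hc2 ⟨(le_max_left _ _).trans_lt hx.1, hx.2⟩)
  have h3 := hp d ⟨hαd, hdβ⟩
  linarith

lemma LSol.start_sign {k : ℕ} {V f f' : ℝ → ℝ} (hf : LSol k V f f') {α β : ℝ} (hα : 0 < α) (hαβ : α < β)
    (hβ : β ≤ 1) (hp : ∀ x ∈ Ioo α β, 0 < f x) (h0 : f α = 0) : 0 ≤ f' α := by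
  by_contra hc
  push Not at hc
  have hcont : ContinuousWithinAt f' (Icc α β) α :=
    (hf.cu'.mono (Icc_subset_Icc hα.le hβ)) α (left_mem_Icc.2 hαβ.le)
  have h1 : ∀ᶠ x in 𝓝[Icc α β] α, f' x < 0 := hcont.eventually_lt_const hc
  have h2 : ∀ᶠ x in 𝓝[>] α, f' x < 0 := by
    rw [← nhdsWithin_Ioc_eq_nhdsGT hαβ]
    exact h1.filter_mono (nhdsWithin_mono _ Ioc_subset_Icc_self)
  obtain ⟨c, hc1, hc2⟩ := (mem_nhdsGT_iff_exists_Ioo_subset' hαβ).1 h2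
  have hc1' : α < c := hc1
  set d := min c ((α+β)/2) with hd
  have hdβ : α < d := lt_min hc1' (by linarith)
  have hαd : d < β := lt_of_le_of_lt (min_le_right _ _) (by linarith)
  have := cmp_lt (g := fun _ => 0) (g' := fun _ => 0) hdβ 
    (hf.cu.mono (Icc_subset_Icc hα.le (hαd.le.trans hβ))) continuousOn_const
    (fun x hx => hf.du x ⟨hα.trans hx.1, (hx.2.trans hαd).trans_le hβ⟩)
    (fun x _ => hasDerivAt_const x 0) 
    (fun x hx => hc2 ⟨hx.1, hx.2.trans_le (min_le_left _ _)⟩)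
  have h3 := hp d ⟨hdβ, hαd⟩
  linarith

lemma closure_nonneg {g : ℝ → ℝ} {α β x : ℝ} (hαβ : α < β) (hg : ContinuousOn g (Icc α β))
    (hp : ∀ x ∈ Ioo α β, 0 < g x) (hx : x ∈ Icc α β) : 0 ≤ g x := by
  have : x ∈ closure (Ioo α β) := by rwa [closure_Ioo hαβ.ne]
  have h1 : ContinuousWithinAt g (Ioo α β) x := (hg x hx).mono Ioo_subset_Icc_self
  have : (𝓝[Ioo α β] x).NeBot := mem_closure_iff_nhdsWithin_neBot.1 this
  exact ge_of_tendsto h1 (eventually_nhdsWithin_of_forall (fun y hy => (hp y hy).le))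

lemma sturm_core {k : ℕ} {V V2 f f' g g' : ℝ → ℝ} (hf : LSol k V f f') (hg : LSol k V2 g g')
    {α β : ℝ} (hα : 0 < α) (hαβ : α < β) (hβ : β ≤ 1) (hV : ∀ x ∈ Ioo α β, V x < V2 x)
    (hfp : ∀ x ∈ Ioo α β, 0 < f x) (hgp : ∀ x ∈ Ioo α β, 0 < g x) (h0 : f β = 0)
    (hs : f α * g' α - f' α * g α ≤ 0) : False := by
  have hsub := Icc_subset_Icc hα.le hβ
  have h1 := hf.end_sign hα hαβ hβ hfp h0
  have h2 := closure_nonneg hαβ (hg.cu.mono hsub) hgp (right_mem_Icc.2 hαβ.le)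
  have := cmp_lt (g := fun _ => 0) (g' := fun _ => 0) hαβ ((hf.cOmega hg).mono hsub) continuousOn_const
    (fun x hx => hf.omega hg ⟨hα.trans hx.1, hx.2.trans_le hβ⟩) (fun x _ => hasDerivAt_const x 0)
    (by
      intro x hx
      have h3 := mul_pos (hfp x hx) (hgp x hx)
      have h4 := hV x hx
      have h5 : 0 < x ^ k := pow_pos (hα.trans hx.1) k
      have h6 : x ^ k * (V x - V2 x) < 0 := mul_neg_of_pos_of_neg h5 (by linarith)
      exact mul_neg_of_neg_of_pos h6 h3)
  simp only [h0] at this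
  have h7 : 0 ≤ β ^ k * (0 * g' β - f' β * g β) :=
    mul_nonneg (pow_pos (hα.trans hαβ) k).le (by nlinarith)
  have h8 : α ^ k * (f α * g' α - f' α * g α) ≤ 0 := mul_nonpos_of_nonneg_of_nonpos (pow_pos hα k).le hs
  linarith

/-- between the start (negative data) and a zero of `f` there is a zero of `g` -/
lemma sturm_neg {k : ℕ} {V V2 f f' g g' : ℝ → ℝ} (hf : LSol k V f f') (hg : LSol k V2 g g')
    {α β : ℝ} (hα : 0 < α) (hαβ : α < β) (hβ : β ≤ 1) (hV : ∀ x ∈ Ioo α β, V x < V2 x)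
    (hfα : f α < 0) (hgα : g α < 0)
    (hfp : ∀ x ∈ Ioo α β, f x ≠ 0) (h0 : f β = 0)
    (hs : f α * g' α - f' α * g α ≤ 0) : ∃ y ∈ Ioo α β, g y = 0 := by
  by_contra hc
  push Not at hc
  have key : ∀ {V h h' : ℝ → ℝ}, LSol k V h h' → h α < 0 → (∀ x ∈ Ioo α β, h x ≠ 0) → ∀ x ∈ Ioo α β, h x < 0 := by
    intro V h h' hh h1 h2
    have hsub := Icc_subset_Icc hα.le hβ
    rcases sign_Ioo ((hh.cu.mono hsub).mono Ioo_subset_Icc_self) h2 with h3 | h3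
    · have := closure_nonneg hαβ (hh.cu.mono hsub) h3 (left_mem_Icc.2 hαβ.le)
      linarith
    · exact h3
  have h1 := key hf hfα hfp
  have h2 := key hg hgα hc
  refine sturm_core hf.smul hg.smul hα hαβ hβ hV (fun x hx => by linarith [h1 x hx])
    (fun x hx => by linarith [h2 x hx]) (by linarith) (by linarith)

lemma sturm_zero {k : ℕ} {V V2 f f' g g' : ℝ → ℝ} (hf : LSol k V f f') (hg : LSol k V2 g g')
    {α β : ℝ} (hα : 0 < α) (hαβ : α < β) (hβ : β ≤ 1) (hV : ∀ x ∈ Ioo α β, V x < V2 x)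
    (hfα : f α = 0) (hfp : ∀ x ∈ Ioo α β, f x ≠ 0) (h0 : f β = 0) : ∃ y ∈ Ioo α β, g y = 0 := by
  by_contra hc
  push Not at hc
  have hsub := Icc_subset_Icc hα.le hβ
  have main : ∀ {F F' G G' : ℝ → ℝ}, LSol k V F F' → LSol k V2 G G' → (∀ x ∈ Ioo α β, 0 < F x) →
      (∀ x ∈ Ioo α β, 0 < G x) → F α = 0 → F β = 0 → False := by
    intro F F' G G' hF hG h1 h2 h3 h4
    refine sturm_core hF hG hα hαβ hβ hV h1 h2 h4 ?_
    have h5 := hF.start_sign hα hαβ hβ h1 h3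
    have h6 := closure_nonneg hαβ (hG.cu.mono hsub) h2 (left_mem_Icc.2 hαβ.le)
    rw [h3]
    nlinarith
  rcases sign_Ioo ((hf.cu.mono hsub).mono Ioo_subset_Icc_self) hfp with h1 | h1 <;>
  rcases sign_Ioo ((hg.cu.mono hsub).mono Ioo_subset_Icc_self) hc with h2 | h2
  · exact main hf hg h1 h2 hfα h0
  · exact main hf hg.smul h1 (fun x hx => by linarith [h2 x hx]) hfα h0
  · exact main hf.smul hg (fun x hx => by linarith [h1 x hx]) h2 (by linarith) (by linarith)
  · exact main hf.smul hg.smul (fun x hx => by linarith [h1 x hx]) (fun x hx => by linarith [h2 x hx]) (by linarith) (by linarith)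

lemma count_le {A B : Set ℝ} (hB : B.Finite)
    (h : ∀ z ∈ A, ∃ y ∈ B, y < z ∧ ∀ z' ∈ A, z' < z → z' < y) : A.ncard ≤ B.ncard := by
  choose! φ h1 h2 h3 using h
  refine Set.ncard_le_ncard_of_injOn φ h1 ?_ hB
  intro x hx y hy hxy
  rcases lt_trichotomy x y with hlt | heq | hlt
  · have := h3 y hy x hx hlt
    have := h2 x hx
    linarith
  · exact heq
  · have := h3 x hx y hy hlt
    have := h2 y hy
    linarith

lemma sturm_count {k : ℕ} {V V2 f f' g g' : ℝ → ℝ} (hf : LSol k V f f') (hg : LSol k V2 g g')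
    {α : ℝ} (hα : 0 < α) (hV : ∀ x ∈ Ioo α 1, V x < V2 x)
    (hfα : f α < 0) (hgα : g α < 0) (hs : f α * g' α - f' α * g α ≤ 0)
    (hA : {z | z ∈ Ioc α 1 ∧ f z = 0}.Finite) (hB : {z | z ∈ Ioo α 1 ∧ g z = 0}.Finite) :
    {z | z ∈ Ioc α 1 ∧ f z = 0}.ncard ≤ {z | z ∈ Ioo α 1 ∧ g z = 0}.ncard := by
  set A := {z | z ∈ Ioc α 1 ∧ f z = 0} with hAdef
  refine count_le hB ?_
  rintro z ⟨hz, hfz⟩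
  by_cases hne : (A ∩ Iio z).Nonempty
  · have hfin : (A ∩ Iio z).Finite := hA.subset inter_subset_left
    obtain ⟨w, hw, hwmax⟩ := hfin.exists_maximal hne
    have hwm : ∀ z' ∈ A, z' < z → z' ≤ w := by
      intro z' h1 h2
      by_contra hc
      push Not at hc
      have := hwmax ⟨h1, h2⟩ hc.le
      linarith
    have hwz : w < z := hw.2
    have hαw : α < w := hw.1.1.1
    obtain ⟨y, hy, hgy⟩ := sturm_zero hf hg (hα.trans hαw) hwz hz.2
      (fun x hx => hV x ⟨hαw.trans hx.1, hx.2.trans_le hz.2⟩) hw.1.2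
      (fun x hx hfx => by
        have := hwm x ⟨⟨hαw.trans hx.1, hx.2.le.trans hz.2⟩, hfx⟩ hx.2
        linarith [hx.1]) hfz
    exact ⟨y, ⟨⟨hαw.trans hy.1, hy.2.trans_le hz.2⟩, hgy⟩, hy.2, fun z' h1 h2 => (hwm z' h1 h2).trans_lt hy.1⟩
  · have hno : ∀ z' ∈ A, z' < z → False := fun z' h1 h2 => hne ⟨z', h1, h2⟩
    obtain ⟨y, hy, hgy⟩ := sturm_neg hf hg hα hz.1 hz.2
      (fun x hx => hV x ⟨hx.1, hx.2.trans_le hz.2⟩) hfα hgα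
      (fun x hx hfx => hno x ⟨⟨hx.1, hx.2.le.trans hz.2⟩, hfx⟩ hx.2) hfz hs
    exact ⟨y, ⟨⟨hy.1, hy.2.trans_le hz.2⟩, hgy⟩, hy.2, fun z' h1 h2 => (hno z' h1 h2).elim⟩

/-- zeros of an eigenfunction are finitely many -/
lemma LSol.finite_zeros {k : ℕ} {μ : ℝ} {ψ ψ' : ℝ → ℝ} (hμ : 0 < μ) (h : LSol k (fun _ => μ) ψ ψ')
    (h0 : ψ 0 = -1) : {z | z ∈ Icc (0:ℝ) 1 ∧ ψ z = 0}.Finite := by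
  by_contra hinf
  have hinf : {z | z ∈ Icc (0:ℝ) 1 ∧ ψ z = 0}.Infinite := hinf
  obtain ⟨x, hx, hacc⟩ := hinf.exists_accPt_of_subset_isCompact isCompact_Icc (fun z hz => hz.1)
  set Z := {z | z ∈ Icc (0:ℝ) 1 ∧ ψ z = 0} with hZ
  have hfr := accPt_iff_frequently.1 hacc
  have hψx : ψ x = 0 := by
    by_contra hne
    have h1 : ContinuousWithinAt ψ (Icc 0 1) x := h.cu x hx
    have h2 := h1.eventually_ne hne
    have h3 := eventually_nhdsWithin_iff.1 h2
    obtain ⟨y, hy1, hy2⟩ := (hfr.and_eventually h3).exists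
    exact hy2 hy1.2.1 hy1.2.2
  have hx0 : 0 < x := by
    rcases hx.1.eq_or_lt with he | hlt
    · rw [← he, h0] at hψx; norm_num at hψx
    · exact hlt
  have hψ'x : ψ' x = 0 := by
    by_contra hne
    have h1 : ContinuousWithinAt ψ' (Icc 0 1) x := h.cu' x hx
    have h2 := eventually_nhdsWithin_iff.1 (h1.eventually_ne hne)
    obtain ⟨ε, hε, hball⟩ := Metric.eventually_nhds_iff.1 h2
    obtain ⟨y, ⟨hyx, hyZ⟩, hyd⟩ := (hfr.and_eventually (Metric.ball_mem_nhds x (lt_min hε hx0))).exists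
    have hd : |y - x| < min ε x := hyd
    have hdε := hd.trans_le (min_le_left _ _)
    have hdx := hd.trans_le (min_le_right _ _)
    have rolle : ∀ p q : ℝ, p < q → 0 < p → q ≤ 1 → ψ p = 0 → ψ q = 0 →
        (∀ t ∈ Ioo p q, |t - x| < ε) → False := by
      intro p q hpq hp hq h1 h2 h3
      obtain ⟨c, hc, hc'⟩ := exists_hasDerivAt_eq_zero hpq (h.cu.mono (Icc_subset_Icc hp.le hq))
        (h1.trans h2.symm) (fun t ht => h.du t ⟨hp.trans ht.1, ht.2.trans_le hq⟩)
      exact hball (h3 c hc) ⟨(hp.trans hc.1).le, hc.2.le.trans hq⟩ hc'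
    have hy0 : 0 < y := by have := (abs_lt.1 hdx).1; linarith
    rcases lt_or_gt_of_ne hyx with hlt | hlt
    · refine rolle y x hlt hy0 hx.2 hyZ.2 hψx (fun t ht => ?_)
      have := (abs_lt.1 hdε).1
      rw [abs_lt]; constructor <;> linarith [ht.1, ht.2]
    · refine rolle x y hlt hx0 hyZ.1.2 hψx hyZ.2 (fun t ht => ?_)
      have := (abs_lt.1 hdε).2
      rw [abs_lt]; constructor <;> linarith [ht.1, ht.2]
  -- energy
  have hz : ∀ r ∈ Ioo 0 x, ψ r = 0 := by
    intro r hr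
    have hsub : Icc r x ⊆ Icc 0 1 := Icc_subset_Icc hr.1.le hx.2
    have c1 := h.cu.mono hsub
    have c2 := h.cu'.mono hsub
    have := cmp_le (f := fun _ => 0) (f' := fun _ => 0)
      (g := fun r => (r ^ k * ψ' r) ^ 2 + μ * (r ^ k * r ^ k * ψ r ^ 2))
      (g' := fun r => μ * (2 * k * (r ^ k * r ^ k / r) * ψ r ^ 2)) hr.2.le continuousOn_const
      (by fun_prop) (fun x _ => hasDerivAt_const x 0)
      (by
        intro t ht
        have ht1 : t ∈ Ioo (0:ℝ) 1 := ⟨hr.1.trans ht.1, ht.2.trans_le hx.2⟩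
        have d1 := (h.hW ht1).fun_pow 2
        have p1 := hasDerivAt_pow' k ht1.1.ne'
        have d2 := ((p1.fun_mul p1).fun_mul ((h.du t ht1).fun_pow 2)).const_mul μ
        refine (d1.add d2).congr_deriv ?_
        push_cast
        ring)
      (by
        intro t ht
        have ht1 := hr.1.trans ht.1
        positivity)
    simp only [hψx, hψ'x] at this
    have hk : 0 < r ^ k * r ^ k := mul_pos (pow_pos hr.1 k) (pow_pos hr.1 k)
    have h1 : 0 < μ * (r ^ k * r ^ k) := mul_pos hμ hk
    by_contra hne
    have h2 : 0 < ψ r ^ 2 := by positivity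
    have h3 := mul_pos h1 h2
    nlinarith [sq_nonneg (r ^ k * ψ' r)]
  have hcont : ContinuousWithinAt ψ (Ioo 0 x) 0 := (h.cu 0 ⟨le_rfl, zero_le_one⟩).mono
    (fun t ht => ⟨ht.1.le, ht.2.le.trans hx.2⟩)
  have : (𝓝[Ioo 0 x] (0:ℝ)).NeBot := by
    apply mem_closure_iff_nhdsWithin_neBot.1
    rw [closure_Ioo hx0.ne]
    exact ⟨le_rfl, hx0.le⟩
  have h1 : Tendsto ψ (𝓝[Ioo 0 x] 0) (𝓝 0) :=
    tendsto_const_nhds.congr' (eventually_nhdsWithin_of_forall (fun y hy => (hz y hy).symm))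
  have := tendsto_nhds_unique hcont h1
  rw [h0] at this
  norm_num at this


/-- radial Dirichlet eigenfunction -/
structure Eig (k : ℕ) (μ : ℝ) (ψ ψ' : ℝ → ℝ) : Prop where
  sol : LSol k (fun _ => μ) ψ ψ'
  μpos : 0 < μ
  ψ0 : ψ 0 = -1
  ψ'0 : ψ' 0 = 0
  ψ1 : ψ 1 = 0

lemma Eig.exists_c {k : ℕ} {μ : ℝ} {ψ ψ' : ℝ → ℝ} (h : Eig k μ ψ ψ') {C : ℝ} (hC : 0 < C) :
    ∃ c, 0 < c ∧ c < 1 ∧ C * c ^ 2 ≤ 1 ∧ ∀ r ∈ Icc 0 c, ψ r ≤ -1/2 := by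
  have h1 : ContinuousWithinAt ψ (Icc 0 1) 0 := h.sol.cu 0 ⟨le_rfl, zero_le_one⟩
  have h2 : ∀ᶠ x in 𝓝[Icc 0 1] 0, ψ x < -1/2 := h1.eventually_lt_const (by rw [h.ψ0]; norm_num)
  obtain ⟨ε, hε, hb⟩ := Metric.eventually_nhds_iff.1 (eventually_nhdsWithin_iff.1 h2)
  refine ⟨min (min (ε/2) (1/2)) (1/(1+C)), by positivity, ?_, ?_, ?_⟩
  · exact lt_of_le_of_lt ((min_le_left _ _).trans (min_le_right _ _)) (by norm_num)
  · set c := min (min (ε/2) (1/2)) (1/(1+C))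
    have hc0 : 0 < c := by positivity
    have hc : c ≤ 1/(1+C) := min_le_right _ _
    rw [le_div_iff₀ (by positivity)] at hc
    have : c ≤ 1 := by nlinarith
    nlinarith
  · intro r hr
    have h3 : r ≤ ε/2 := hr.2.trans ((min_le_left _ _).trans (min_le_left _ _))
    have h4 : r ≤ 1/2 := hr.2.trans ((min_le_left _ _).trans (min_le_right _ _))
    refine (hb (y := r) ?_ ⟨hr.1, by linarith⟩).le
    rw [Real.dist_eq, sub_zero, abs_of_nonneg hr.1]
    linarith

lemma Eig.der_nonneg {k : ℕ} {μ : ℝ} {ψ ψ' : ℝ → ℝ} (h : Eig k μ ψ ψ') {c : ℝ} (hc : c < 1)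
    (hψ : ∀ r ∈ Icc 0 c, ψ r ≤ -1/2) {r : ℝ} (hr : r ∈ Ioc 0 c) : 0 ≤ ψ' r := by
  have hr1 := hr.2.trans_lt hc
  have := cmp_le (f := fun _ => 0) (f' := fun _ => 0) hr.1.le continuousOn_const
    (h.sol.cW.mono (Icc_subset_Icc_right hr1.le)) (fun x _ => hasDerivAt_const x 0)
    (fun x hx => h.sol.hW ⟨hx.1, hx.2.trans hr1⟩)
    (by
      intro x hx
      have h1 := hψ x ⟨hx.1.le, hx.2.le.trans hr.2⟩
      have h2 : 0 < x ^ k := pow_pos hx.1 k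
      have h3 := h.μpos
      have : μ * ψ x ≤ 0 := mul_nonpos_of_nonneg_of_nonpos h3.le (by linarith)
      nlinarith)
  simp only [h.ψ'0, mul_zero, sub_zero] at this
  exact nonneg_of_mul_nonneg_right this (pow_pos hr.1 k)

namespace Outer
variable {k : ℕ} {ν lam γ a ρ s M μ c : ℝ} {u u' ψ ψ' : ℝ → ℝ}

lemma count_lt (h : Outer k ν lam γ a ρ s M u u') (hE : Eig k μ ψ ψ') (hc : c < 1)
    (hψ : ∀ r ∈ Icc 0 c, ψ r ≤ -1/2) (hsc : s ≤ c) (hlt : M ^ (2/ν) + lam < μ)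
    (hfin : {r : ℝ | r ∈ Ioo (0:ℝ) 1 ∧ u r = 0}.Finite) :
    {z | z ∈ Ioc s 1 ∧ u z = 0}.ncard ≤ {z | z ∈ Ioo s 1 ∧ ψ z = 0}.ncard := by
  have hs0 := h.s0
  have hν := h.bump.νpos
  refine sturm_count h.bump.sol hE.sol hs0 ?_ (h.ltz ⟨h.ρs, le_rfl⟩) ?_ ?_ ?_ ?_
  · intro x hx
    have := rpow_le_rpow (abs_nonneg _) (h.bound x ⟨(h.ρs.trans hx.1).le, hx.2.le⟩) (by positivity : 0 ≤ 2/ν)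
    linarith
  · linarith [hψ s ⟨hs0.le, hsc⟩]
  · rw [h.us, h.u's]
    have := hE.der_nonneg hc hψ ⟨hs0, hsc⟩
    nlinarith [h.Mpos]
  · refine (hfin.insert 1).subset ?_
    rintro z ⟨hz, hz'⟩
    rcases hz.2.eq_or_lt with he | hlt
    · exact Or.inl he
    · exact Or.inr ⟨⟨hs0.trans hz.1, hlt⟩, hz'⟩
  · exact (hE.sol.finite_zeros hE.μpos hE.ψ0).subset
      (fun z hz => ⟨⟨(hs0.trans hz.1.1).le, hz.1.2.le⟩, hz.2⟩)

lemma count_gt (h : Outer k ν lam γ a ρ s M u u') (hE : Eig k μ ψ ψ') (hc : c < 1)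
    (hψ : ∀ r ∈ Icc 0 c, ψ r ≤ -1/2) (hsc : s < c) {C η : ℝ} (hC : M ^ (2/ν) + lam ≤ C)
    (hCc : C * c ^ 2 ≤ 1) (hη : 0 < η) (hlt : μ + η ≤ lam)
    (hη2 : s ^ k * ψ' s ≤ η / 4 * ((c ^ (k+1) - s ^ (k+1)) / (k+1)))
    (hfin : {r : ℝ | r ∈ Ioo (0:ℝ) 1 ∧ u r = 0}.Finite) :
    {z | z ∈ Ioc c 1 ∧ ψ z = 0}.ncard ≤ {z | z ∈ Ioo c 1 ∧ u z = 0}.ncard := by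
  have hs0 := h.s0
  have hM := h.Mpos
  have hν := h.bump.νpos
  have hc0 := hs0.trans hsc
  have hfin2 := hE.sol.finite_zeros hE.μpos hE.ψ0
  refine sturm_count hE.sol h.bump.sol hc0 ?_ ?_ ?_ ?_ ?_ ?_
  · intro x hx
    have : 0 ≤ |u x| ^ (2/ν) := by positivity
    linarith
  · linarith [hψ c ⟨hc0.le, le_rfl⟩]
  · linarith [h.near hc hC hCc ⟨hsc.le, le_rfl⟩]
  · have hsub := Icc_subset_Icc hs0.le hc.le
    have := cmp_le (g := fun r => -(M * (η / 4) * (r ^ (k+1) / (k+1))))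
      (g' := fun r => -(M * (η / 4) * r ^ k)) hsc.le ((hE.sol.cOmega h.bump.sol).mono hsub)
      (by fun_prop) (fun x hx => hE.sol.omega h.bump.sol ⟨hs0.trans hx.1, hx.2.trans hc⟩)
      (by
        intro x hx
        refine (((((hasDerivAt_pow (k+1) x).div_const ((k:ℝ)+1)).const_mul _)).fun_neg).congr_deriv ?_
        push_cast
        field_simp)
      (by
        intro x hx
        have h1 := hψ x ⟨(hs0.trans hx.1).le, hx.2.le⟩
        have h2 := h.near hc hC hCc ⟨hx.1.le, hx.2.le⟩
        have h3 : 0 ≤ |u x| ^ (2/ν) := by positivity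
        have h4 : M/4 ≤ ψ x * u x := by nlinarith
        have h5 : 0 < x ^ k := pow_pos (hs0.trans hx.1) k
        have h6 : η * (M/4) ≤ (|u x| ^ (2/ν) + lam - μ) * (ψ x * u x) :=
          mul_le_mul (by linarith) h4 (by positivity) (by linarith)
        have h7 := mul_le_mul_of_nonneg_left h6 h5.le
        linarith)
    simp only [h.us, h.u's] at this
    have h8 := mul_le_mul_of_nonneg_left hη2 hM.le
    have h9 : c ^ k * (ψ c * u' c - ψ' c * u c) ≤ 0 := by
      have e1 : M * (η / 4 * ((c ^ (k+1) - s ^ (k+1)) / (k+1))) =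
        M * (η / 4) * (c ^ (k+1) / (k+1)) - M * (η / 4) * (s ^ (k+1) / (k+1)) := by ring
      rw [e1] at h8
      linarith
    exact nonpos_of_mul_nonpos_right h9 (pow_pos hc0 k)
  · exact hfin2.subset (fun z hz => ⟨⟨(hc0.trans hz.1.1).le, hz.1.2⟩, hz.2⟩)
  · exact hfin.subset (fun z hz => ⟨⟨hc0.trans hz.1.1, hz.1.2⟩, hz.2⟩)

lemma zero_le_s (h : Outer k ν lam γ a ρ s M u u') {z : ℝ} (hz0 : 0 < z) (hzs : z ≤ s) (hz : u z = 0) :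
    z = ρ := by
  rcases lt_trichotomy z ρ with hlt | he | hgt
  · have := h.bump.pos z ⟨hz0.le, hlt⟩; linarith
  · exact he
  · have := h.ltz ⟨hgt, hzs⟩; linarith

end Outer

lemma lam_eq {k m : ℕ} {ν μ lamBar : ℝ} {ψ ψ' : ℝ → ℝ} (hE : Eig k μ ψ ψ') (hm : 2 ≤ m) (hν : 0 < ν)
    (hlb : 0 < lamBar)
    (hk : k ≠ 0) (hZψ : {r : ℝ | r ∈ Ioo (0:ℝ) 1 ∧ ψ r = 0}.ncard = m - 1 - 1)
    {lam γ a ρ s M : ℕ → ℝ} {u u' : ℕ → ℝ → ℝ}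
    (hO : ∀ᶠ n in atTop, Outer k ν (lam n) (γ n) (a n) (ρ n) (s n) (M n) (u n) (u' n))
    (hZ : ∀ n, {r : ℝ | r ∈ Ioo (0:ℝ) 1 ∧ u n r = 0}.ncard = m - 1)
    (hs : Tendsto s atTop (𝓝 0)) (hM : Tendsto M atTop (𝓝 0)) (hlam : Tendsto lam atTop (𝓝 lamBar)) :
    lamBar = μ := by
  have hMp : Tendsto (fun n => M n ^ (2/ν)) atTop (𝓝 0) := by
    have := hM.rpow_const (p := 2/ν) (Or.inr (by positivity))
    rwa [zero_rpow (by positivity)] at this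
  have hV : Tendsto (fun n => M n ^ (2/ν) + lam n) atTop (𝓝 lamBar) := by
    simpa using hMp.add hlam
  obtain ⟨c, hc0, hc1, hCc, hψc⟩ := hE.exists_c (C := 2 * lamBar) (by positivity)
  have hfin : ∀ n, {r : ℝ | r ∈ Ioo (0:ℝ) 1 ∧ u n r = 0}.Finite :=
    fun n => Set.finite_of_ncard_pos (by rw [hZ]; omega)
  have hfinψ : {r : ℝ | r ∈ Ioo (0:ℝ) 1 ∧ ψ r = 0}.Finite :=
    (hE.sol.finite_zeros hE.μpos hE.ψ0).subset (fun z hz => ⟨⟨hz.1.1.le, hz.1.2.le⟩, hz.2⟩)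
  have hsc := hs.eventually_lt_const hc0
  have hdiff : ∀ n, Outer k ν (lam n) (γ n) (a n) (ρ n) (s n) (M n) (u n) (u' n) →
      ({r : ℝ | r ∈ Ioo (0:ℝ) 1 ∧ u n r = 0} \ {ρ n}).ncard = m - 2 := by
    intro n h
    rw [Set.ncard_sdiff_singleton_of_mem (show ρ n ∈ {r : ℝ | r ∈ Ioo (0:ℝ) 1 ∧ u n r = 0} from ⟨⟨h.bump.ρ0, h.bump.ρ1⟩, h.bump.uρ⟩), hZ]
    omega
  rcases lt_trichotomy lamBar μ with hlt | he | hgt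
  · exfalso
    obtain ⟨n, h, hn1, hn2⟩ := (hO.and (hsc.and (hV.eventually_lt_const hlt))).exists
    have h1 := h.count_lt hE hc1 hψc hn1.le hn2 (hfin n)
    have h2 : {z | z ∈ Ioo (s n) 1 ∧ ψ z = 0}.ncard ≤ m - 1 - 1 := by
      rw [← hZψ]
      exact Set.ncard_le_ncard (fun z hz => ⟨⟨h.s0.trans hz.1.1, hz.1.2⟩, hz.2⟩) hfinψ
    have h3 : insert 1 ({r : ℝ | r ∈ Ioo (0:ℝ) 1 ∧ u n r = 0} \ {ρ n}) ⊆ {z | z ∈ Ioc (s n) 1 ∧ u n z = 0} := by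
      rintro z (rfl | ⟨⟨hz1, hz2⟩, hz3⟩)
      · exact ⟨⟨h.s1, le_rfl⟩, h.bump.u1⟩
      · refine ⟨⟨?_, hz1.2.le⟩, hz2⟩
        by_contra hc
        push Not at hc
        exact hz3 (h.zero_le_s hz1.1 hc hz2)
    have h4 := Set.ncard_le_ncard h3 (((hfin n).insert 1).subset (by
      rintro z ⟨hz, hz'⟩
      rcases hz.2.eq_or_lt with he | hlt
      · exact Or.inl he
      · exact Or.inr ⟨⟨h.s0.trans hz.1, hlt⟩, hz'⟩))
    rw [Set.ncard_insert_of_notMem (fun hh => absurd hh.1.1.2 (lt_irrefl _)) ((hfin n).subset sdiff_subset),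
      hdiff n h] at h4
    omega
  · exact he
  · exfalso
    set η := (lamBar - μ) / 2 with hη
    have hηp : 0 < η := by rw [hη]; linarith
    have hψ's : Tendsto (fun n => s n ^ k * ψ' (s n)) atTop (𝓝 0) := by
      have h1 : ContinuousWithinAt (fun x => x ^ k * ψ' x) (Icc 0 1) 0 := hE.sol.cW 0 ⟨le_rfl, zero_le_one⟩
      have h2 : Tendsto s atTop (𝓝[Icc 0 1] 0) := tendsto_nhdsWithin_iff.2 ⟨hs, by
        filter_upwards [hO] with n hn using ⟨hn.s0.le, hn.s1.le⟩⟩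
      have := h1.tendsto.comp h2
      simpa [zero_pow hk, Function.comp_def] using this
    have hR : Tendsto (fun n => η / 4 * ((c ^ (k+1) - s n ^ (k+1)) / (k+1))) atTop
        (𝓝 (η / 4 * ((c ^ (k+1) - 0 ^ (k+1)) / (k+1)))) :=
      (((tendsto_const_nhds.sub (hs.pow (k+1))).div_const _).const_mul _)
    have hlt := hψ's.eventually_lt hR (by
      rw [zero_pow (by omega), sub_zero]
      positivity)
    obtain ⟨n, h, hn1, hn2, hn3, hn4⟩ := (hO.and (hsc.and (hlt.and
      ((hV.eventually_lt_const (show lamBar < 2 * lamBar by linarith)).and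
      (hlam.eventually_const_lt (show μ + η < lamBar by rw [hη]; linarith)))))).exists
    have h1 := h.count_gt hE hc1 hψc hn1 hn3.le hCc hηp hn4.le hn2.le (hfin n)
    have h2 : {z | z ∈ Ioo c 1 ∧ u n z = 0}.ncard ≤ m - 2 := by
      rw [← hdiff n h]
      refine Set.ncard_le_ncard (fun z hz => ⟨⟨⟨hc0.trans hz.1.1, hz.1.2⟩, hz.2⟩, ?_⟩) ((hfin n).subset sdiff_subset)
      intro he
      have he : z = ρ n := he
      have := h.ρs
      linarith [hz.1.1]
    have h3 : insert 1 {r : ℝ | r ∈ Ioo (0:ℝ) 1 ∧ ψ r = 0} ⊆ {z | z ∈ Ioc c 1 ∧ ψ z = 0} := by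
      rintro z (rfl | ⟨hz1, hz2⟩)
      · exact ⟨⟨hc1, le_rfl⟩, hE.ψ1⟩
      · refine ⟨⟨?_, hz1.2.le⟩, hz2⟩
        by_contra hc
        push Not at hc
        have := hψc z ⟨hz1.1.le, hc⟩
        linarith
    have h4 := Set.ncard_le_ncard h3 ((hE.sol.finite_zeros hE.μpos hE.ψ0).subset
      (fun z hz => ⟨⟨(hc0.trans hz.1.1).le, hz.1.2⟩, hz.2⟩))
    rw [Set.ncard_insert_of_notMem (fun hh => absurd hh.1.2 (lt_irrefl _)) hfinψ, hZψ] at h4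
    omega


structure Fam (k : ℕ) (ν lamBar : ℝ) (g : ℝ → ℝ) (lam γ a ρ s M : ℕ → ℝ) (u u' : ℕ → ℝ → ℝ) : Prop where
  out : ∀ᶠ n in atTop, Outer k ν (lam n) (γ n) (a n) (ρ n) (s n) (M n) (u n) (u' n)
  ν1 : 1 ≤ ν
  ν2 : ν ≤ 3/2
  lpos : 0 < lamBar
  lim : Tendsto lam atTop (𝓝 lamBar)
  blow : Tendsto γ atTop atTop
  adef : ∀ n, a n = γ n ^ (2 / ν) / (4 * ν * (ν + 1))
  gc : Continuous g
  g0 : g 0 = 0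
  gd : ∀ t > 0, HasDerivAt g (t ^ k * (1 + t ^ 2) ^ (-(2*ν))) t
  G1 : Tendsto (fun x : ℝ => x ^ (ν-1) * g (√(x ^ (1/4:ℝ)))) atTop atTop
  G2 : Tendsto (fun x : ℝ => x ^ (ν/2-1) * g (√x)) atTop (𝓝 0)

namespace Fam
variable {k : ℕ} {ν lamBar : ℝ} {g : ℝ → ℝ} {lam γ a ρ s M : ℕ → ℝ} {u u' : ℕ → ℝ → ℝ}

lemma νpos (h : Fam k ν lamBar g lam γ a ρ s M u u') : 0 < ν := by linarith [h.ν1]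

lemma gmono (h : Fam k ν lamBar g lam γ a ρ s M u u') {x y : ℝ} (hx : 0 ≤ x) (hxy : x ≤ y) : g x ≤ g y := by
  have := cmp_le (f := fun _ => 0) (f' := fun _ => 0) hxy continuousOn_const h.gc.continuousOn
    (fun x _ => hasDerivAt_const x 0) (fun t ht => h.gd t (hx.trans_lt ht.1)) (fun t ht => by
      have := hx.trans_lt ht.1
      positivity)
  linarith

lemma gnn (h : Fam k ν lamBar g lam γ a ρ s M u u') {x : ℝ} (hx : 0 ≤ x) : 0 ≤ g x := by
  rw [← h.g0]; exact h.gmono le_rfl hx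

lemma a_top (h : Fam k ν lamBar g lam γ a ρ s M u u') : Tendsto a atTop atTop := by
  have hν := h.νpos
  have h1 := ((tendsto_rpow_atTop (show 0 < 2/ν by positivity)).comp h.blow).atTop_div_const
    (show 0 < 4 * ν * (ν + 1) by positivity)
  exact h1.congr (fun n => (h.adef n).symm)

lemma D0 (hν1 : 0 < ν) (hν2 : ν ≤ 3/2) :
    Tendsto (fun x : ℝ => x ^ (1/4:ℝ) * (1 + x ^ (1/4:ℝ)) ^ ν / (4 * (ν+1) * x)) atTop (𝓝 0) := by
  have h1 : Tendsto (fun x : ℝ => 2 ^ ν * x ^ (-(3/8:ℝ))) atTop (𝓝 0) := by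
    simpa using (tendsto_rpow_neg_atTop (show (0:ℝ) < 3/8 by norm_num)).const_mul ((2:ℝ)^ν)
  refine squeeze_zero' ?_ ?_ h1
  · filter_upwards [eventually_gt_atTop 0] with x hx
    positivity
  · filter_upwards [eventually_ge_atTop 1] with x hx
    have hx0 : 0 < x := by linarith
    have hX : 1 ≤ x ^ (1/4:ℝ) := one_le_rpow hx (by norm_num)
    have h2 : (1 + x ^ (1/4:ℝ)) ^ ν ≤ (2 * x ^ (1/4:ℝ)) ^ ν :=
      rpow_le_rpow (by positivity) (by linarith) hν1.le
    rw [mul_rpow (by norm_num) (by positivity), ← rpow_mul hx0.le] at h2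
    have h3 : x ^ (1/4 * ν : ℝ) ≤ x ^ (3/8:ℝ) := rpow_le_rpow_of_exponent_le hx (by linarith)
    rw [div_le_iff₀ (by positivity)]
    have e : x ^ (-(3/8:ℝ)) * x = x ^ (1/4:ℝ) * x ^ (3/8:ℝ) := by
      rw [← rpow_add hx0]
      nth_rewrite 2 [← rpow_one x]
      rw [← rpow_add hx0]
      norm_num
    calc x ^ (1/4:ℝ) * (1 + x ^ (1/4:ℝ)) ^ ν ≤ x ^ (1/4:ℝ) * (2 ^ ν * x ^ (3/8:ℝ)) := by
          refine mul_le_mul_of_nonneg_left (h2.trans ?_) (by positivity)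
          exact mul_le_mul_of_nonneg_left h3 (by positivity)
      _ = 2 ^ ν * (x ^ (-(3/8:ℝ)) * x) := by rw [e]; ring
      _ ≤ 2 ^ ν * (x ^ (-(3/8:ℝ)) * x) * (4 * (ν+1)) := by
          refine le_mul_of_one_le_right (by positivity) (by linarith)
      _ = _ := by ring

/-- the small parameter -/
noncomputable def del (ν : ℝ) (lam a : ℕ → ℝ) (n : ℕ) : ℝ :=
  lam n * (a n ^ (1/4:ℝ) * (1 + a n ^ (1/4:ℝ)) ^ ν / (4 * (ν+1) * a n))

lemma del_lim (h : Fam k ν lamBar g lam γ a ρ s M u u') : Tendsto (del ν lam a) atTop (𝓝 0) := by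
  have := h.lim.mul ((D0 h.νpos h.ν2).comp h.a_top)
  rw [mul_zero] at this
  exact this

lemma del_spec (h : Fam k ν lamBar g lam γ a ρ s M u u') {n : ℕ} (ha : 0 < a n) :
    lam n * a n ^ (1/4:ℝ) * (1 + a n ^ (1/4:ℝ)) ^ ν ≤ 4 * (ν+1) * a n * del ν lam a n := by
  have := h.νpos
  rw [del]
  apply le_of_eq
  field_simp

lemma X_top (h : Fam k ν lamBar g lam γ a ρ s M u u') : Tendsto (fun n => a n ^ (1/4:ℝ)) atTop atTop :=
  (tendsto_rpow_atTop (by norm_num)).comp h.a_top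

lemma ev (h : Fam k ν lamBar g lam γ a ρ s M u u') : ∀ᶠ n in atTop,
    Outer k ν (lam n) (γ n) (a n) (ρ n) (s n) (M n) (u n) (u' n) ∧ del ν lam a n < 1 ∧ lam n < 2 * lamBar ∧
    0 < γ n * a n ^ (-ν) := by
  filter_upwards [h.out, h.del_lim.eventually_lt_const zero_lt_one,
    h.lim.eventually_lt_const (show lamBar < 2 * lamBar by linarith [h.lpos])] with n h1 h2 h3
  have := h1.bump.apos
  have := h1.bump.γpos
  exact ⟨h1, h2, h3, by positivity⟩

/-- normalised flux -/
noncomputable def t (k : ℕ) (ν : ℝ) (γ a ρ : ℕ → ℝ) (u' : ℕ → ℝ → ℝ) (n : ℕ) : ℝ :=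
  -(ρ n ^ k * u' n (ρ n)) / (γ n * a n ^ (-ν))

lemma t_upper (h : Fam k ν lamBar g lam γ a ρ s M u u') :
    ∀ᶠ n in atTop, t k ν γ a ρ u' n ≤ 2 * ν + lam n * ρ n ^ 2 / 2 := by
  filter_upwards [h.ev] with n ⟨h1, _, _, h4⟩
  rw [t, div_le_iff₀ h4]
  linarith [h1.bump.b_upper]

lemma t_lower (h : Fam k ν lamBar g lam γ a ρ s M u u') :
    ∀ᶠ n in atTop, (1 - del ν lam a n) ^ (2/ν) * (1 - del ν lam a n) *
      (2 * ν * (a n ^ (1/4:ℝ) / (1 + a n ^ (1/4:ℝ))) ^ (ν+1)) ≤ t k ν γ a ρ u' n := by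
  filter_upwards [h.ev] with n ⟨h1, h2, _, h4⟩
  have ha := h1.bump.apos
  rw [t, le_div_iff₀ h4]
  have := h1.bump.b_lower (X := a n ^ (1/4:ℝ)) (by positivity) h2 (h.del_spec ha)
  refine le_trans (le_of_eq ?_) this
  ring

lemma L_lim (h : Fam k ν lamBar g lam γ a ρ s M u u') :
    Tendsto (fun n => (1 - del ν lam a n) ^ (2/ν) * (1 - del ν lam a n) *
      (2 * ν * (a n ^ (1/4:ℝ) / (1 + a n ^ (1/4:ℝ))) ^ (ν+1))) atTop (𝓝 (2*ν)) := by
  have hν := h.νpos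
  have h1 : Tendsto (fun n => 1 - del ν lam a n) atTop (𝓝 1) := by
    simpa using h.del_lim.const_sub 1
  have h2 : Tendsto (fun n => (1 - del ν lam a n) ^ (2/ν)) atTop (𝓝 1) := by
    simpa using h1.rpow_const (p := 2/ν) (Or.inl one_ne_zero)
  have h3 : Tendsto (fun n => a n ^ (1/4:ℝ) / (1 + a n ^ (1/4:ℝ))) atTop (𝓝 1) := by
    have h4 : Tendsto (fun n => 1 - 1 / (1 + a n ^ (1/4:ℝ))) atTop (𝓝 (1 - 0)) :=
      tendsto_const_nhds.sub (tendsto_const_nhds.div_atTop (tendsto_atTop_add_const_left _ _ h.X_top))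
    rw [sub_zero] at h4
    refine h4.congr' ?_
    filter_upwards [h.X_top.eventually_gt_atTop 0] with n hn
    field_simp
    ring
  have h4 : Tendsto (fun n => (a n ^ (1/4:ℝ) / (1 + a n ^ (1/4:ℝ))) ^ (ν+1)) atTop (𝓝 1) := by
    simpa using h3.rpow_const (p := ν+1) (Or.inl one_ne_zero)
  simpa using (h2.mul h1).mul (h4.const_mul (2*ν))

lemma P_lower (h : Fam k ν lamBar g lam γ a ρ s M u u') :
    ∀ᶠ n in atTop, (1 - del ν lam a n) ^ 2 * (2 * lam n * (a n ^ (ν-1) * g (√(a n ^ (1/4:ℝ))))) ≤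
      t k ν γ a ρ u' n ^ 2 * ρ n ^ (-(2*ν)) := by
  filter_upwards [h.ev] with n ⟨h1, h2, _, h4⟩
  have ha := h1.bump.apos
  have := h1.bump.poh_lower h.gc h.g0 h.gd (X := a n ^ (1/4:ℝ)) (by positivity) h2 (h.del_spec ha)
  rw [t, div_pow, div_mul_eq_mul_div, le_div_iff₀ (by positivity)]
  refine le_trans (le_of_eq ?_) this
  ring

lemma P_upper (h : Fam k ν lamBar g lam γ a ρ s M u u') :
    ∀ᶠ n in atTop, t k ν γ a ρ u' n ^ 2 * ρ n ^ (-(2*ν)) ≤ 2 * lam n * (a n ^ (ν-1) * g (√(a n) * ρ n)) := by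
  filter_upwards [h.ev] with n ⟨h1, h2, _, h4⟩
  have := h1.bump.poh_upper h.gc h.g0 h.gd
  rw [t, div_pow, div_mul_eq_mul_div, div_le_iff₀ (by positivity)]
  refine le_trans this (le_of_eq ?_)
  ring

lemma t_pos (h : Fam k ν lamBar g lam γ a ρ s M u u') : ∀ᶠ n in atTop, ν ≤ t k ν γ a ρ u' n := by
  filter_upwards [h.t_lower, h.L_lim.eventually_const_lt (show ν < 2 * ν by linarith [h.νpos])] with n h1 h2
  linarith

lemma ρ_lim (h : Fam k ν lamBar g lam γ a ρ s M u u') : Tendsto ρ atTop (𝓝 0) := by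
  have hν := h.νpos
  have hl := h.lpos
  have h1 : Tendsto (fun n => (1 - del ν lam a n) ^ 2 * (2 * lam n * (a n ^ (ν-1) * g (√(a n ^ (1/4:ℝ)))))) atTop atTop := by
    have h2 : Tendsto (fun n => (1 - del ν lam a n) ^ 2 * (2 * lam n)) atTop (𝓝 ((1-0)^2 * (2 * lamBar))) :=
      ((h.del_lim.const_sub 1).pow 2).mul (h.lim.const_mul 2)
    have := (h.G1.comp h.a_top).atTop_mul_pos (show 0 < (1-0)^2 * (2 * lamBar) by positivity) h2
    refine this.congr (fun n => ?_)
    simp only [Function.comp]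
    ring
  have h3 : Tendsto (fun n => ρ n ^ (-(2*ν))) atTop atTop := by
    refine tendsto_atTop_mono' _ ?_ (h1.atTop_div_const (show 0 < (2*ν + lamBar)^2 by positivity))
    filter_upwards [h.P_lower, h.t_upper, h.t_pos, h.ev] with n h4 h5 h6 ⟨h7, _, h8, _⟩
    rw [div_le_iff₀ (by positivity)]
    refine h4.trans ?_
    have hρ := h7.bump.ρ0
    have hρ1 := h7.bump.ρ1
    have hlp := h7.bump.lpos
    have h9 : t k ν γ a ρ u' n ≤ 2*ν + lamBar := by
      have : ρ n ^ 2 ≤ 1 := pow_le_one₀ hρ.le hρ1.le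
      nlinarith
    rw [mul_comm]
    gcongr
    linarith
  have h4 := (tendsto_rpow_neg_atTop (show 0 < 1/(2*ν) by positivity)).comp h3
  refine h4.congr' ?_
  filter_upwards [h.out] with n hn
  have hρ := hn.bump.ρ0
  simp only [Function.comp]
  rw [← rpow_mul hρ.le]
  have : -(2*ν) * -(1/(2*ν)) = 1 := by field_simp
  rw [this, rpow_one]

lemma t_lim (h : Fam k ν lamBar g lam γ a ρ s M u u') : Tendsto (t k ν γ a ρ u') atTop (𝓝 (2*ν)) := by
  refine tendsto_of_tendsto_of_tendsto_of_le_of_le' h.L_lim ?_ h.t_lower h.t_upper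
  have := ((h.lim.mul (h.ρ_lim.pow 2)).div_const 2).const_add (2*ν)
  simpa using this

lemma M_le' (h : Fam k ν lamBar g lam γ a ρ s M u u') : ∀ᶠ n in atTop,
    M n ≤ t k ν γ a ρ u' n * (γ n * a n ^ (-ν)) * (ρ n ^ (-(2*ν)) / (2*ν)) := by
  filter_upwards [h.ev] with n ⟨h1, _, _, h4⟩
  rw [t, div_mul_cancel₀ _ h4.ne']
  exact h1.M_le

lemma β_eq (h : Fam k ν lamBar g lam γ a ρ s M u u') : ∀ᶠ n in atTop,
    γ n * a n ^ (-ν) = (4 * ν * (ν+1)) ^ (ν/2) * a n ^ (-(ν/2)) := by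
  filter_upwards [h.out] with n hn
  have hν := h.νpos
  have ha := hn.bump.apos
  have hγ := hn.bump.γpos
  have e : γ n = (4 * ν * (ν+1)) ^ (ν/2) * a n ^ (ν/2) := by
    rw [← mul_rpow (by positivity) ha.le, h.adef n, mul_div_cancel₀ _ (by positivity), ← rpow_mul hγ.le]
    have : 2 / ν * (ν/2) = 1 := by field_simp
    rw [this, rpow_one]
  nth_rewrite 1 [e]
  rw [mul_assoc, ← rpow_add ha]
  congr 2
  ring

lemma M_lim (h : Fam k ν lamBar g lam γ a ρ s M u u') : Tendsto M atTop (𝓝 0) := by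
  have hν := h.νpos
  have hl := h.lpos
  have h1 : Tendsto (fun n => (4 * ν * (ν+1)) ^ (ν/2) * (2 * lamBar) / (ν * ν) * (a n ^ (ν/2-1) * g (√(a n)))) atTop (𝓝 0) := by
    simpa using (h.G2.comp h.a_top).const_mul ((4 * ν * (ν+1)) ^ (ν/2) * (2 * lamBar) / (ν * ν))
  refine squeeze_zero' ?_ ?_ h1
  · filter_upwards [h.out] with n hn using hn.Mpos.le
  · filter_upwards [h.M_le', h.β_eq, h.P_upper, h.t_pos, h.ev] with n h2 h3 h4 h5 ⟨h6, _, h7, h8⟩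
    have ha := h6.bump.apos
    have hρ := h6.bump.ρ0
    have hρ1 := h6.bump.ρ1
    have hlp := h6.bump.lpos
    have hg : g (√(a n) * ρ n) ≤ g (√(a n)) := h.gmono (by positivity)
      (mul_le_of_le_one_right (by positivity) hρ1.le)
    have hg0 := h.gnn (sqrt_nonneg (a n))
    set T := t k ν γ a ρ u' n
    have hT : 0 < T := by linarith
    have h9 : T ^ 2 * ρ n ^ (-(2*ν)) ≤ 2 * (2 * lamBar) * (a n ^ (ν-1) * g (√(a n))) := by
      refine h4.trans ?_
      gcongr
      exact mul_nonneg (by positivity) (h.gnn (by positivity))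
    have e1 : a n ^ (-(ν/2)) * a n ^ (ν-1) = a n ^ (ν/2-1) := by
      rw [← rpow_add ha]; congr 1; ring
    rw [h3] at h2
    set c := (4 * ν * (ν+1)) ^ (ν/2)
    have hc : 0 < c := by positivity
    have h10 : M n * T ≤ c * (2 * lamBar) / ν * (a n ^ (ν/2-1) * g (√(a n))) := by
      calc M n * T ≤ T * (c * a n ^ (-(ν/2))) * (ρ n ^ (-(2*ν)) / (2*ν)) * T := by gcongr
        _ = c * a n ^ (-(ν/2)) / (2*ν) * (T ^ 2 * ρ n ^ (-(2*ν))) := by ring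
        _ ≤ c * a n ^ (-(ν/2)) / (2*ν) * (2 * (2 * lamBar) * (a n ^ (ν-1) * g (√(a n)))) := by gcongr
        _ = c * (2 * lamBar) / ν * ((a n ^ (-(ν/2)) * a n ^ (ν-1)) * g (√(a n))) := by
          field_simp
        _ = _ := by rw [e1]
    have h11 : M n * ν ≤ M n * T := by gcongr; exact h6.Mpos.le
    calc M n = M n * ν / ν := by field_simp
      _ ≤ c * (2 * lamBar) / ν * (a n ^ (ν/2-1) * g (√(a n))) / ν :=
        div_le_div_of_nonneg_right (h11.trans h10) hν.le
      _ = _ := by field_simp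

end Fam


namespace Fam
variable {k : ℕ} {ν lamBar : ℝ} {g : ℝ → ℝ} {lam γ a ρ s M : ℕ → ℝ} {u u' : ℕ → ℝ → ℝ}

/-- second small parameter -/
noncomputable def ee (k : ℕ) (ν : ℝ) (lam ρ M : ℕ → ℝ) (u' : ℕ → ℝ → ℝ) (n : ℕ) : ℝ :=
  (M n ^ (2/ν) + lam n) * M n * ((ρ n ^ (3/4:ℝ)) ^ (k+1) / (k+1)) / -(ρ n ^ k * u' n (ρ n))

lemma Mp_lim (h : Fam k ν lamBar g lam γ a ρ s M u u') : Tendsto (fun n => M n ^ (2/ν)) atTop (𝓝 0) := by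
  have hν := h.νpos
  have := h.M_lim.rpow_const (p := 2/ν) (Or.inr (by positivity))
  rwa [zero_rpow (by positivity)] at this

lemma ρp_lim (h : Fam k ν lamBar g lam γ a ρ s M u u') {p : ℝ} (hp : 0 < p) :
    Tendsto (fun n => ρ n ^ p) atTop (𝓝 0) := by
  have := h.ρ_lim.rpow_const (p := p) (Or.inr hp.le)
  rwa [zero_rpow hp.ne'] at this

lemma ee_lim (h : Fam k ν lamBar g lam γ a ρ s M u u') : Tendsto (ee k ν lam ρ M u') atTop (𝓝 0) := by
  have hν := h.νpos
  have hl := h.lpos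
  have hν2 := h.ν2
  have h1 : Tendsto (fun n => (M n ^ (2/ν) + lam n) / (2*ν*(k+1)) * ρ n ^ ((3-ν)/2)) atTop
      (𝓝 ((0 + lamBar) / (2*ν*(k+1)) * 0)) :=
    ((h.Mp_lim.add h.lim).div_const _).mul (h.ρp_lim (by linarith))
  rw [mul_zero] at h1
  refine squeeze_zero' ?_ ?_ h1
  · filter_upwards [h.out] with n hn
    have := hn.bpos
    have := hn.Mpos
    have := hn.bump.lpos
    have := hn.bump.ρ0
    rw [ee]
    positivity
  · filter_upwards [h.out] with n hn
    have hb := hn.bpos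
    have hM := hn.Mpos
    have hl := hn.bump.lpos
    have hρ := hn.bump.ρ0
    have hle := hn.M_le
    have hk := hn.bump.kν
    rw [ee]
    set b := -(ρ n ^ k * u' n (ρ n))
    have e1 : ρ n ^ (-(2*ν)) * (ρ n ^ (3/4:ℝ)) ^ (k+1) = ρ n ^ ((3-ν)/2) := by
      rw [← rpow_natCast, ← rpow_mul hρ.le, ← rpow_add hρ]
      congr 1
      push_cast
      rw [hk]
      ring
    rw [div_le_iff₀ hb]
    calc (M n ^ (2/ν) + lam n) * M n * ((ρ n ^ (3/4:ℝ)) ^ (k+1) / (k+1)) 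
        ≤ (M n ^ (2/ν) + lam n) * (b * (ρ n ^ (-(2*ν)) / (2*ν))) * ((ρ n ^ (3/4:ℝ)) ^ (k+1) / (k+1)) := by gcongr
      _ = (M n ^ (2/ν) + lam n) / (2*ν*(k+1)) * (ρ n ^ (-(2*ν)) * (ρ n ^ (3/4:ℝ)) ^ (k+1)) * b := by
        field_simp
      _ = _ := by rw [e1]

lemma mid (h : Fam k ν lamBar g lam γ a ρ s M u u') : ∀ᶠ n in atTop,
    ρ n ≤ ρ n ^ (3/4:ℝ) ∧ ρ n ^ (3/4:ℝ) ≤ s n ∧ (1 - ee k ν lam ρ M u' n) * -(ρ n ^ k * u' n (ρ n)) *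
      (ρ n ^ (-(2*ν)) / (2*ν) * (1 - ρ n ^ (ν/2))) ≤ -u n (ρ n ^ (3/4:ℝ)) := by
  filter_upwards [h.out, h.ee_lim.eventually_lt_const zero_lt_one] with n hn he
  have hρ := hn.bump.ρ0
  have hρ1 := hn.bump.ρ1
  have hb := hn.bpos
  have hK : 1 ≤ ρ n ^ (-(1/4):ℝ) := one_le_rpow_of_pos_of_le_one_of_nonpos hρ hρ1.le (by norm_num)
  have e1 : ρ n ^ (-(1/4):ℝ) * ρ n = ρ n ^ (3/4:ℝ) := by
    nth_rewrite 2 [← rpow_one (ρ n)]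
    rw [← rpow_add hρ]
    norm_num
  have e2 : (ρ n ^ (-(1/4):ℝ)) ^ (-(2*ν)) = ρ n ^ (ν/2) := by
    rw [← rpow_mul hρ.le]; congr 1; ring
  have := hn.O2 hK he (by rw [e1, ee, div_mul_cancel₀ _ hb.ne'])
  rw [e1, e2] at this
  refine ⟨?_, this⟩
  rw [← e1]
  exact le_mul_of_one_le_left hρ.le hK

/-- M normalised by the flux -/
lemma Mb_lim (h : Fam k ν lamBar g lam γ a ρ s M u u') :
    Tendsto (fun n => M n * ρ n ^ (2*ν) / -(ρ n ^ k * u' n (ρ n))) atTop (𝓝 (1/(2*ν))) := by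
  have hν := h.νpos
  have h1 : Tendsto (fun n => (1 - ee k ν lam ρ M u' n) * (1/(2*ν) * (1 - ρ n ^ (ν/2)))) atTop
     (𝓝 ((1 - 0) * (1/(2*ν) * (1 - 0)))) :=
    (h.ee_lim.const_sub 1).mul (((h.ρp_lim (by positivity)).const_sub 1).const_mul _)
  simp only [sub_zero, mul_one, one_mul] at h1
  refine tendsto_of_tendsto_of_tendsto_of_le_of_le' h1 tendsto_const_nhds ?_ ?_
  · filter_upwards [h.out, h.mid] with n hn ⟨hm1, hm2, hm3⟩
    have hρ := hn.bump.ρ0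
    have hb := hn.bpos
    have hbd := (neg_le_abs _).trans (hn.bound _ ⟨hm1, hm2.trans hn.s1.le⟩)
    rw [le_div_iff₀ hb]
    have e : ρ n ^ (-(2*ν)) * ρ n ^ (2*ν) = 1 := by rw [← rpow_add hρ]; simp
    have := mul_le_mul_of_nonneg_right (hm3.trans hbd) (by positivity : 0 ≤ ρ n ^ (2*ν))
    refine le_trans (le_of_eq ?_) this
    set b := -(ρ n ^ k * u' n (ρ n))
    calc _ = (1 - ee k ν lam ρ M u' n) * b * (1/(2*ν) * (1 - ρ n ^ (ν/2))) * (ρ n ^ (-(2*ν)) * ρ n ^ (2*ν)) := by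
          rw [e]; ring
      _ = _ := by ring
  · filter_upwards [h.out] with n hn
    have hρ := hn.bump.ρ0
    have hb := hn.bpos
    rw [div_le_iff₀ hb]
    have e : ρ n ^ (-(2*ν)) * ρ n ^ (2*ν) = 1 := by rw [← rpow_add hρ]; simp
    have := mul_le_mul_of_nonneg_right hn.M_le (by positivity : 0 ≤ ρ n ^ (2*ν))
    refine le_trans this (le_of_eq ?_)
    set b := -(ρ n ^ k * u' n (ρ n))
    calc _ = b / (2*ν) * (ρ n ^ (-(2*ν)) * ρ n ^ (2*ν)) := by ring
      _ = _ := by rw [e]; ring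

lemma Mβ_lim (h : Fam k ν lamBar g lam γ a ρ s M u u') :
    Tendsto (fun n => M n * ρ n ^ (2*ν) / (γ n * a n ^ (-ν))) atTop (𝓝 1) := by
  have hν := h.νpos
  have := h.Mb_lim.mul h.t_lim
  have e : 1/(2*ν) * (2*ν) = 1 := by field_simp
  rw [e] at this
  refine this.congr' ?_
  filter_upwards [h.ev] with n ⟨hn, _, _, hβ⟩
  have hb := hn.bpos
  rw [t]
  generalize -(ρ n ^ k * u' n (ρ n)) = b at hb
  field_simp

lemma s_lim (h : Fam k ν lamBar g lam γ a ρ s M u u') : Tendsto s atTop (𝓝 0) := by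
  have hν := h.νpos
  have hlb := h.lpos
  set Q : ℕ → ℝ := fun n => lam n * ((1 - ee k ν lam ρ M u' n) * (1/(2*ν) * (1 - ρ n ^ (ν/2)))) with hQ
  have hQl : Tendsto Q atTop (𝓝 (lamBar * ((1 - 0) * (1/(2*ν) * (1 - 0))))) :=
    h.lim.mul ((h.ee_lim.const_sub 1).mul (((h.ρp_lim (by positivity)).const_sub 1).const_mul _))
  have hQp : 0 < lamBar * ((1 - 0) * (1/(2*ν) * (1 - 0))) := by
    simp only [sub_zero, mul_one, one_mul]; positivity
  have h1 : Tendsto (fun n => (ρ n ^ (3/4:ℝ)) ^ (k+1) + (k+1) * ρ n ^ (2*ν) / Q n) atTop (𝓝 0) := by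
    have := ((h.ρp_lim (show (0:ℝ) < 3/4 by norm_num)).pow (k+1)).add
      (((h.ρp_lim (show 0 < 2*ν by positivity)).const_mul ((k:ℝ)+1)).div hQl hQp.ne')
    simpa using this
  have h2 : Tendsto (fun n => s n ^ (k+1)) atTop (𝓝 0) := by
    refine squeeze_zero' ?_ ?_ h1
    · filter_upwards [h.out] with n hn
      have := hn.s0
      positivity
    · filter_upwards [h.out, h.mid, hQl.eventually_const_lt hQp] with n hn ⟨hm1, hm2, hm3⟩ hq
      have hρ := hn.bump.ρ0
      have hl := hn.bump.lpos
      have hb := hn.bpos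
      have h3 := hn.O3 ⟨hm1, hm2⟩
      have h4 : 0 ≤ (s n ^ (k+1) - (ρ n ^ (3/4:ℝ)) ^ (k+1)) / (k+1) := by
        apply div_nonneg _ (by positivity)
        have := pow_le_pow_left₀ (by positivity) hm2 (k+1)
        linarith
      have h5 := (mul_le_mul_of_nonneg_right (mul_le_mul_of_nonneg_left hm3 hl.le) h4).trans h3
      set D := s n ^ (k+1) - (ρ n ^ (3/4:ℝ)) ^ (k+1) with hD
      set b := -(ρ n ^ k * u' n (ρ n))
      have h6 : b * (Q n * ρ n ^ (-(2*ν)) * (D / (k+1))) ≤ b * 1 := by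
        refine le_trans (le_of_eq ?_) (h5.trans_eq (mul_one b).symm)
        simp only [hQ]; ring
      have h7 := le_of_mul_le_mul_left h6 hb
      have h8 : D ≤ (k+1) * ρ n ^ (2*ν) / Q n := by
        rw [rpow_neg hρ.le] at h7
        have hp : 0 < ρ n ^ (2*ν) := by positivity
        generalize ρ n ^ (2*ν) = p at *
        rw [le_div_iff₀ hq]
        have : Q n * p⁻¹ * (D / (k+1)) = D * Q n / (p * (k+1)) := by field_simp
        rw [this, div_le_one (by positivity)] at h7
        linarith
      linarith
  have h3 := h2.rpow_const (p := (((k+1 : ℕ) : ℝ))⁻¹) (Or.inr (by positivity))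
  rw [zero_rpow (by positivity)] at h3
  refine h3.congr' ?_
  filter_upwards [h.out] with n hn
  exact pow_rpow_inv_natCast hn.s0.le (by omega)

lemma G_lim (h : Fam k ν lamBar g lam γ a ρ s M u u') {G : ℝ} (hG : Tendsto g atTop (𝓝 G)) :
    Tendsto (fun n => ρ n ^ (-(2*ν)) / a n ^ (ν-1)) atTop (𝓝 (2 * lamBar * G / (2*ν)^2)) := by
  have hν := h.νpos
  have hle : ∀ x, 0 ≤ x → g x ≤ G := fun x hx => ge_of_tendsto hG (by
    filter_upwards [eventually_ge_atTop x] with y hy using h.gmono hx hy)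
  have h1 : Tendsto (fun n => t k ν γ a ρ u' n ^ 2 * ρ n ^ (-(2*ν)) / a n ^ (ν-1)) atTop (𝓝 (2 * lamBar * G)) := by
    have hlo : Tendsto (fun n => (1 - del ν lam a n) ^ 2 * (2 * lam n * g (√(a n ^ (1/4:ℝ))))) atTop
        (𝓝 ((1-0)^2 * (2 * lamBar * G))) :=
      ((h.del_lim.const_sub 1).pow 2).mul ((h.lim.const_mul 2).mul
        (hG.comp (tendsto_sqrt_atTop.comp h.X_top)))
    have hup : Tendsto (fun n => 2 * lam n * G) atTop (𝓝 (2 * lamBar * G)) := (h.lim.const_mul 2).mul_const G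
    simp only [sub_zero, one_pow, one_mul] at hlo
    refine tendsto_of_tendsto_of_tendsto_of_le_of_le' hlo hup ?_ ?_
    · filter_upwards [h.P_lower, h.out] with n h2 hn
      have ha := hn.bump.apos
      rw [le_div_iff₀ (by positivity)]
      linarith
    · filter_upwards [h.P_upper, h.out] with n h2 hn
      have ha := hn.bump.apos
      have hl := hn.bump.lpos
      have hρ := hn.bump.ρ0
      rw [div_le_iff₀ (by positivity)]
      refine h2.trans ?_
      have := hle (√(a n) * ρ n) (by positivity)
      have h3 : 2 * lam n * (a n ^ (ν-1) * g (√(a n) * ρ n)) ≤ 2 * lam n * (a n ^ (ν-1) * G) := by gcongr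
      linarith
  have h2 := h1.div (h.t_lim.pow 2) (by positivity)
  refine h2.congr' ?_
  filter_upwards [h.t_pos] with n hn
  have : 0 < t k ν γ a ρ u' n := by linarith
  simp only [Pi.div_apply]
  field_simp

lemma unif (h : Fam k ν lamBar g lam γ a ρ s M u u') {μ : ℝ} {ψ ψ' : ℝ → ℝ} (hE : Eig k μ ψ ψ')
    (hμ : lamBar = μ) {c : ℝ} (hc : 0 < c) :
      TendstoUniformlyOn (fun n x => u n x / M n) ψ atTop (Set.Icc c 1) ∧
      TendstoUniformlyOn (fun n x => u' n x / M n) ψ' atTop (Set.Icc c 1) := by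
  have hμp := hE.μpos
  set R : ℕ → ℝ := fun n => rexp 1 * (ψ' (s n) ^ 2 + μ * (1 + ψ (s n)) ^ 2 + (|μ - lam n| + M n ^ (2/ν)) ^ 2) with hR
  have hRl : Tendsto R atTop (𝓝 0) := by
    have h2 : Tendsto s atTop (𝓝[Icc 0 1] 0) := tendsto_nhdsWithin_iff.2 ⟨h.s_lim, by
        filter_upwards [h.out] with n hn using ⟨hn.s0.le, hn.s1.le⟩⟩
    have h3 : Tendsto (fun n => ψ (s n)) atTop (𝓝 (-1)) := by
      have := (hE.sol.cu 0 ⟨le_rfl, zero_le_one⟩).tendsto.comp h2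
      rwa [hE.ψ0] at this
    have h4 : Tendsto (fun n => ψ' (s n)) atTop (𝓝 0) := by
      have := (hE.sol.cu' 0 ⟨le_rfl, zero_le_one⟩).tendsto.comp h2
      rwa [hE.ψ'0] at this
    have h5 : Tendsto (fun n => |μ - lam n|) atTop (𝓝 |μ - lamBar|) := (h.lim.const_sub μ).abs
    have h6 := (((h4.pow 2).add (((h3.const_add 1).pow 2).const_mul μ)).add ((h5.add h.Mp_lim).pow 2)).const_mul (rexp 1)
    rw [← hμ] at h6
    simp only [hR, ← hμ]
    simpa using h6
  have hs := h.s_lim.eventually_lt_const hc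
  constructor
  · rw [Metric.tendstoUniformlyOn_iff]
    intro ε hε
    filter_upwards [h.out, hs, hRl.eventually_lt_const (show 0 < μ * ε^2 by positivity)] with n hn hsn hRn x hx
    have h1 := hn.conv hμp hE.sol (r := x) ⟨hsn.le.trans hx.1, hx.2⟩
    have h2 : μ * (u n x / M n - ψ x) ^ 2 < μ * ε ^ 2 := by
      have : R n = rexp 1 * (ψ' (s n) ^ 2 + μ * (1 + ψ (s n)) ^ 2 + (|μ - lam n| + M n ^ (2/ν)) ^ 2) := rfl
      nlinarith [sq_nonneg (u' n x / M n - ψ' x)]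
    have h3 := lt_of_mul_lt_mul_left h2 hμp.le
    rw [dist_comm, Real.dist_eq]
    exact abs_lt_of_sq_lt_sq h3 hε.le
  · rw [Metric.tendstoUniformlyOn_iff]
    intro ε hε
    filter_upwards [h.out, hs, hRl.eventually_lt_const (show 0 < ε^2 by positivity)] with n hn hsn hRn x hx
    have h1 := hn.conv hμp hE.sol (r := x) ⟨hsn.le.trans hx.1, hx.2⟩
    have h3 : (u' n x / M n - ψ' x) ^ 2 < ε ^ 2 := by
      have : R n = rexp 1 * (ψ' (s n) ^ 2 + μ * (1 + ψ (s n)) ^ 2 + (|μ - lam n| + M n ^ (2/ν)) ^ 2) := rfl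
      have : 0 ≤ μ * (u n x / M n - ψ x) ^ 2 := by positivity
      linarith
    rw [dist_comm, Real.dist_eq]
    exact abs_lt_of_sq_lt_sq h3 hε.le

end Fam


/-- primitive for N = 4 -/
noncomputable def g4 (y : ℝ) : ℝ := 1/2 * (log (1 + y^2) + 1/(1+y^2) - 1)

/-- primitive for N = 5 -/
noncomputable def g5 (y : ℝ) : ℝ := 3/8 * arctan y - (5*y^3+3*y)/(8*(1+y^2)^2)

lemma g4_cont : Continuous g4 := by
  unfold g4
  have h : ∀ y : ℝ, 1 + y^2 ≠ 0 := fun y => by positivity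
  fun_prop (disch := exact h _)

lemma g5_cont : Continuous g5 := by
  unfold g5
  have h : ∀ y : ℝ, 8*(1+y^2)^2 ≠ 0 := fun y => by positivity
  fun_prop (disch := exact h _)

lemma g4_der (t : ℝ) (ht : 0 < t) : HasDerivAt g4 (t ^ 3 * (1 + t ^ 2) ^ (-(2*(1:ℝ)))) t := by
  have h0 : 1 + t^2 ≠ 0 := by positivity
  have d : HasDerivAt (fun y : ℝ => 1 + y^2) (2*t) t := by
    simpa using (hasDerivAt_pow 2 t).const_add 1
  have d1 := ((((d.log h0).fun_add ((hasDerivAt_const t (1:ℝ)).fun_div d h0)).sub_const 1).const_mul (1/2))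
  refine HasDerivAt.congr_deriv d1 ?_
  rw [show (-(2*(1:ℝ))) = -((2:ℕ):ℝ) by norm_num, rpow_neg (by positivity), rpow_natCast]
  field_simp
  ring

lemma g5_der (t : ℝ) (ht : 0 < t) : HasDerivAt g5 (t ^ 4 * (1 + t ^ 2) ^ (-(2*(3/2:ℝ)))) t := by
  have h0 : 1 + t^2 ≠ 0 := by positivity
  have h1 : 8*(1 + t^2)^2 ≠ 0 := by positivity
  have d : HasDerivAt (fun y : ℝ => 1 + y^2) (2*t) t := by
    simpa using (hasDerivAt_pow 2 t).const_add 1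
  have d2 := (d.fun_pow 2).const_mul 8
  have d3 := ((hasDerivAt_pow 3 t).const_mul 5).fun_add ((hasDerivAt_id' t).const_mul 3)
  have d1 := ((hasDerivAt_arctan t).const_mul (3/8)).fun_sub (d3.fun_div d2 h1)
  refine HasDerivAt.congr_deriv d1 ?_
  rw [show (-(2*(3/2:ℝ))) = -((3:ℕ):ℝ) by norm_num, rpow_neg (by positivity), rpow_natCast]
  push_cast
  field_simp
  ring

lemma g4_G1 : Tendsto (fun x : ℝ => x ^ ((1:ℝ)-1) * g4 (√(x ^ (1/4:ℝ)))) atTop atTop := by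
  have h1 : Tendsto (fun x : ℝ => 1/2 * (log (x ^ (1/4:ℝ)) + (-1))) atTop atTop :=
    (tendsto_atTop_add_const_right _ _ (tendsto_log_atTop.comp (tendsto_rpow_atTop (by norm_num)))).const_mul_atTop (by norm_num)
  refine tendsto_atTop_mono' _ ?_ h1
  filter_upwards [eventually_gt_atTop 0] with x hx
  rw [sub_self, rpow_zero, one_mul, g4, sq_sqrt (by positivity)]
  have hX : 0 < x ^ (1/4:ℝ) := by positivity
  have h2 := log_le_log hX (by linarith : x ^ (1/4:ℝ) ≤ 1 + x ^ (1/4:ℝ))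
  have h3 : 0 < 1 / (1 + x ^ (1/4:ℝ)) := by positivity
  linarith

lemma g4_G2 : Tendsto (fun x : ℝ => x ^ ((1:ℝ)/2-1) * g4 (√x)) atTop (𝓝 0) := by
  have h1 : Tendsto (fun x : ℝ => 2 * 2 ^ (1/4:ℝ) * x ^ (-(1/4:ℝ))) atTop (𝓝 0) := by
    simpa using (tendsto_rpow_neg_atTop (show (0:ℝ) < 1/4 by norm_num)).const_mul (2 * 2 ^ (1/4:ℝ))
  refine squeeze_zero' ?_ ?_ h1
  · filter_upwards [eventually_gt_atTop 0] with x hx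
    rw [g4, sq_sqrt hx.le]
    have := one_sub_inv_le_log_of_pos (show 0 < 1 + x by linarith)
    rw [inv_eq_one_div] at this
    exact mul_nonneg (by positivity) (by linarith)
  · filter_upwards [eventually_ge_atTop 1] with x hx
    have hx0 : 0 < x := by linarith
    rw [g4, sq_sqrt hx0.le]
    have h2 := log_le_rpow_div (show 0 ≤ 1 + x by linarith) (show (0:ℝ) < 1/4 by norm_num)
    have h3 : (1 + x) ^ (1/4:ℝ) ≤ (2 * x) ^ (1/4:ℝ) := rpow_le_rpow (by linarith) (by linarith) (by norm_num)
    rw [mul_rpow (by norm_num) hx0.le] at h3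
    have h4 : 1/(1+x) ≤ 1 := by rw [div_le_one (by linarith)]; linarith
    have h5 : 1/2 * (log (1 + x) + 1/(1+x) - 1) ≤ 2 * 2 ^ (1/4:ℝ) * x ^ (1/4:ℝ) := by
      linarith
    have e : x ^ ((1:ℝ)/2-1) * x ^ (1/4:ℝ) = x ^ (-(1/4:ℝ)) := by
      rw [← rpow_add hx0]; norm_num
    calc _ ≤ x ^ ((1:ℝ)/2-1) * (2 * 2 ^ (1/4:ℝ) * x ^ (1/4:ℝ)) := by gcongr
      _ = 2 * 2 ^ (1/4:ℝ) * (x ^ ((1:ℝ)/2-1) * x ^ (1/4:ℝ)) := by ring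
      _ = _ := by rw [e]

lemma g5_lim : Tendsto g5 atTop (𝓝 (3 * π / 16)) := by
  have h1 : Tendsto (fun y : ℝ => (5*y^3+3*y)/(8*(1+y^2)^2)) atTop (𝓝 0) := by
    refine squeeze_zero' ?_ ?_ tendsto_inv_atTop_zero
    · filter_upwards [eventually_gt_atTop 0] with x hx
      positivity
    · filter_upwards [eventually_ge_atTop 1] with x hx
      have hx0 : 0 < x := by linarith
      rw [inv_eq_one_div, div_le_div_iff₀ (by positivity) hx0]
      nlinarith [pow_pos hx0 4, pow_pos hx0 2]
  have h2 := ((tendsto_arctan_atTop.mono_right nhdsWithin_le_nhds).const_mul (3/8)).sub h1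
  have e : 3/8 * (π/2) - 0 = 3 * π / 16 := by ring
  rw [e] at h2
  exact h2

lemma g5_G1 : Tendsto (fun x : ℝ => x ^ ((3/2:ℝ)-1) * g5 (√(x ^ (1/4:ℝ)))) atTop atTop :=
  (tendsto_rpow_atTop (by norm_num)).atTop_mul_pos (show 0 < 3 * π / 16 by positivity)
    (g5_lim.comp (tendsto_sqrt_atTop.comp (tendsto_rpow_atTop (by norm_num))))

lemma g5_G2 : Tendsto (fun x : ℝ => x ^ ((3/2:ℝ)/2-1) * g5 (√x)) atTop (𝓝 0) := by
  have h1 := (tendsto_rpow_neg_atTop (show (0:ℝ) < 1/4 by norm_num)).mul (g5_lim.comp tendsto_sqrt_atTop)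
  rw [zero_mul] at h1
  refine h1.congr (fun x => ?_)
  norm_num [Function.comp]

lemma BNSol.lsol {N m k : ℕ} {lam ν : ℝ} {u u' u'' : ℝ → ℝ} (h : BNSol N lam m u u' u'')
    (hk : (N:ℝ) - 1 = k) (hν : (4:ℝ) / ((N:ℝ) - 2) = 2/ν) :
    LSol k (fun r => |u r| ^ (2/ν) + lam) u u' where
  cu := fun r hr => (h.deriv_fst r hr).continuousWithinAt
  cu' := fun r hr => (h.deriv_snd r hr).continuousWithinAt
  du := fun r hr => (h.deriv_fst r ⟨hr.1.le, hr.2.le⟩).hasDerivAt (Icc_mem_nhds hr.1 hr.2)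
  du' := fun r hr => ((h.deriv_snd r ⟨hr.1.le, hr.2.le⟩).hasDerivAt (Icc_mem_nhds hr.1 hr.2)).congr_deriv (by
    have := h.ode r hr
    rw [hk, hν] at this
    linarith)

lemma RadialEigenpair.eig {N m k : ℕ} {μ : ℝ} {u u' u'' : ℝ → ℝ} (h : RadialEigenpair N μ u u' u'' m)
    (hk : (N:ℝ) - 1 = k) : Eig k μ u u' where
  sol :=
  { cu := fun r hr => (h.deriv_fst r hr).continuousWithinAt
    cu' := fun r hr => (h.deriv_snd r hr).continuousWithinAt
    du := fun r hr => (h.deriv_fst r ⟨hr.1.le, hr.2.le⟩).hasDerivAt (Icc_mem_nhds hr.1 hr.2)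
    du' := fun r hr => ((h.deriv_snd r ⟨hr.1.le, hr.2.le⟩).hasDerivAt (Icc_mem_nhds hr.1 hr.2)).congr_deriv (by
      have := h.ode r hr
      rw [hk] at this
      linarith) }
  μpos := h.pos
  ψ0 := h.norm_zero
  ψ'0 := h.bc_deriv_zero
  ψ1 := h.bc_one

lemma BNSol.bump {N m k : ℕ} {lam ν ρ : ℝ} {u u' u'' : ℝ → ℝ} (h : BNSol N lam m u u' u'')
    (hk : (N:ℝ) - 1 = k) (hν : (4:ℝ) / ((N:ℝ) - 2) = 2/ν) (hν0 : 0 < ν) (hkν : (k:ℝ) = 2*ν+1)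
    (hm : 2 ≤ m) (hl : 0 < lam) (hρ : IsFirstZero u ρ) :
    Bump k ν lam (u 0) (u 0 ^ (2/ν) / (4*ν*(ν+1))) ρ u u' := by
  obtain ⟨hρ1, hρ2, hρ3⟩ := hρ
  have hsol := h.lsol hk hν
  refine ⟨hsol, rfl, h.pos_zero, hl, hν0, hkν, rfl, hρ1.1, ?_, hρ2, ?_, h.bc_one⟩
  · rcases hρ1.2.eq_or_lt with he | hlt
    · exfalso
      have h1 := h.nodal
      have h2 : {r : ℝ | r ∈ Ioo (0:ℝ) 1 ∧ u r = 0} = ∅ := by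
        ext r
        simp only [mem_ofPred_eq, mem_empty_iff_false, iff_false]
        rintro ⟨hr, hr'⟩
        exact hρ3 r (by rwa [he]) hr'
      rw [h2, Set.ncard_empty] at h1
      omega
    · exact hlt
  · intro r hr
    by_contra hc
    push Not at hc
    obtain ⟨z, hz, hz'⟩ := intermediate_value_Icc' hr.1
      (hsol.cu.mono (Icc_subset_Icc_right (hr.2.le.trans hρ1.2))) (show (0:ℝ) ∈ Icc (u r) (u 0) from ⟨hc, h.pos_zero.le⟩)
    rcases hz.1.eq_or_lt with he | hlt
    · rw [← he] at hz'
      linarith [h.pos_zero]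
    · exact hρ3 z ⟨hlt, hz.2.trans_lt hr.2⟩ hz'

lemma assemble {N m k : ℕ} {ν lamBar μ : ℝ} {g ψ ψ' ψ'' : ℝ → ℝ} {lam r M : ℕ → ℝ} {u u' u'' : ℕ → ℝ → ℝ}
    (hk : (N:ℝ) - 1 = k) (hν : (4:ℝ) / ((N:ℝ) - 2) = 2/ν) (hkν : (k:ℝ) = 2*ν+1) (hm : 2 ≤ m)
    (ν1 : 1 ≤ ν) (ν2 : ν ≤ 3/2)
    (hlamBar : 0 < lamBar) (heig : RadialEigenpair N μ ψ ψ' ψ'' (m - 1))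
    (hlam : Tendsto lam atTop (𝓝 lamBar))
    (hsol : ∀ n, BNSol N (lam n) m (u n) (u' n) (u'' n))
    (hfz : ∀ n, IsFirstZero (u n) (r n))
    (hblow : Tendsto (fun n => u n 0) atTop atTop)
    (hM : ∀ n, M n = sSup ((fun s => |u n s|) '' Set.Icc (r n) 1))
    (gc : Continuous g) (g0 : g 0 = 0)
    (gd : ∀ t > 0, HasDerivAt g (t ^ k * (1 + t ^ 2) ^ (-(2*ν))) t)
    (G1 : Tendsto (fun x : ℝ => x ^ (ν-1) * g (√(x ^ (1/4:ℝ)))) atTop atTop)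
    (G2 : Tendsto (fun x : ℝ => x ^ (ν/2-1) * g (√x)) atTop (𝓝 0)) :
    ∃ s : ℕ → ℝ, Fam k ν lamBar g lam (fun n => u n 0) (fun n => u n 0 ^ (2/ν) / (4*ν*(ν+1))) r s M u u' ∧
      lamBar = μ ∧
    (∀ a : ℝ, 0 < a → a ≤ 1 →
      TendstoUniformlyOn (fun n s => u n s / M n) ψ atTop (Set.Icc a 1) ∧
      TendstoUniformlyOn (fun n s => u' n s / M n) ψ' atTop (Set.Icc a 1)) ∧
    Tendsto M atTop (𝓝 0) := by
  have h1 : ∀ n, ∃ s, 0 < lam n → Outer k ν (lam n) (u n 0) (u n 0 ^ (2/ν) / (4*ν*(ν+1))) (r n) s (M n) (u n) (u' n) := by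
    intro n
    by_cases hl : 0 < lam n
    · obtain ⟨s, hs⟩ := exists_outer ((hsol n).bump hk hν (by linarith) hkν hm hl (hfz n)) (hM n)
      exact ⟨s, fun _ => hs⟩
    · exact ⟨0, fun h => absurd h hl⟩
  choose s hs using h1
  have hF : Fam k ν lamBar g lam (fun n => u n 0) (fun n => u n 0 ^ (2/ν) / (4*ν*(ν+1))) r s M u u' :=
    { out := by
        filter_upwards [hlam.eventually_const_lt hlamBar] with n hn using hs n hn
      ν1 := ν1, ν2 := ν2, lpos := hlamBar, lim := hlam, blow := hblow, adef := fun n => rfl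
      gc := gc, g0 := g0, gd := gd, G1 := G1, G2 := G2 }
  have hE := heig.eig hk
  have hk0 : k ≠ 0 := by
    rintro rfl
    simp at hkν
    linarith
  have hμ : lamBar = μ := lam_eq hE hm hF.νpos hlamBar hk0 heig.nodal hF.out (fun n => (hsol n).nodal)
    hF.s_lim hF.M_lim hlam
  exact ⟨s, hF, hμ, fun a ha _ => hF.unif hE hμ ha, hF.M_lim⟩

theorem statement11 (N : ℕ) (hN : N = 4 ∨ N = 5) (m : ℕ) (hm : 2 ≤ m)
    (lamBar : ℝ) (hlamBar : 0 < lamBar)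
    (μ : ℝ) (ψ ψ' ψ'' : ℝ → ℝ) (heig : RadialEigenpair N μ ψ ψ' ψ'' (m - 1))
    (lam : ℕ → ℝ) (hlam : Tendsto lam atTop (𝓝 lamBar))
    (u u' u'' : ℕ → ℝ → ℝ) (r : ℕ → ℝ)
    (hsol : ∀ n, BNSol N (lam n) m (u n) (u' n) (u'' n))
    (hfz : ∀ n, IsFirstZero (u n) (r n))
    (hblow : Tendsto (fun n => u n 0) atTop atTop)
    (M : ℕ → ℝ) (hM : ∀ n, M n = sSup ((fun s => |u n s|) '' Set.Icc (r n) 1)) :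
    lamBar = μ ∧
    -- C¹ convergence on compact subsets of (0,1]
    (∀ a : ℝ, 0 < a → a ≤ 1 →
      TendstoUniformlyOn (fun n s => u n s / M n) ψ atTop (Set.Icc a 1) ∧
      TendstoUniformlyOn (fun n s => u' n s / M n) ψ' atTop (Set.Icc a 1)) ∧
    Tendsto M atTop (𝓝 0) ∧
    (N = 4 → Tendsto (fun n => M n * r n ^ 2 * u n 0) atTop (𝓝 8)) ∧
    (N = 5 → Tendsto (fun n => M n / r n ^ ((3:ℝ)/2)) atTop
      (𝓝 (((5:ℝ)/3) ^ ((3:ℝ)/4) * (π * μ / 8) ^ ((3:ℝ)/2)))) := by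
  rcases hN with rfl | rfl
  · obtain ⟨s, hF, h1, h2, h3⟩ := assemble (k := 3) (ν := 1) (by norm_num) (by norm_num) (by norm_num) hm le_rfl
      (by norm_num) hlamBar heig hlam hsol hfz hblow hM g4_cont (by norm_num [g4]) g4_der g4_G1 g4_G2
    refine ⟨h1, h2, h3, fun _ => ?_, fun h => by omega⟩
    have h4 := hF.Mβ_lim.const_mul 8
    rw [mul_one (8:ℝ)] at h4
    refine h4.congr' ?_
    filter_upwards [hblow.eventually_gt_atTop 0] with n hn
    beta_reduce
    rw [rpow_neg_one, show (2:ℝ)*1 = ((2:ℕ):ℝ) by norm_num, show (2:ℝ)/1 = ((2:ℕ):ℝ) by norm_num,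
      rpow_natCast, rpow_natCast]
    field_simp
    ring
  · obtain ⟨s, hF, h1, h2, h3⟩ := assemble (k := 4) (ν := 3/2) (by norm_num) (by norm_num) (by norm_num) hm (by norm_num)
      le_rfl hlamBar heig hlam hsol hfz hblow hM g5_cont (by norm_num [g5]) g5_der g5_G1 g5_G2
    refine ⟨h1, h2, h3, fun h => by omega, fun _ => ?_⟩
    have hμ := heig.pos
    have h4 := (hF.G_lim g5_lim).rpow_const (p := 3/2) (Or.inr (by norm_num))
    have h5 := (hF.Mβ_lim.mul h4).mul_const ((15:ℝ) ^ (3/4:ℝ))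
    have e : 1 * (2 * lamBar * (3 * π / 16) / (2 * (3 / 2)) ^ 2) ^ (3/2:ℝ) * (15:ℝ) ^ (3/4:ℝ) =
        ((5:ℝ)/3) ^ ((3:ℝ)/4) * (π * μ / 8) ^ ((3:ℝ)/2) := by
      rw [h1, show 2 * μ * (3 * π / 16) / (2 * (3 / 2)) ^ 2 = (π * μ / 8) * (1/3) by ring,
        mul_rpow (by positivity) (by norm_num), show (15:ℝ) = (5/3) * (3 ^ (2:ℝ)) by norm_num,
        mul_rpow (by norm_num) (by positivity), ← rpow_mul (by norm_num), one_div,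
        inv_rpow (by norm_num), show (2:ℝ) * (3/4) = 3/2 by norm_num]
      have : (0:ℝ) < 3 ^ (3/2:ℝ) := by positivity
      field_simp
    rw [e] at h5
    refine h5.congr' ?_
    filter_upwards [hF.out, hF.β_eq] with n hn hβ
    have ha := hn.bump.apos
    have hρ := hn.bump.ρ0
    beta_reduce at ha hβ ⊢
    rw [hβ]
    generalize u n 0 ^ (2 / (3/2:ℝ)) / (4 * (3/2) * (3/2+1)) = A at ha
    rw [div_rpow (by positivity) (by positivity), ← rpow_mul hρ.le, ← rpow_mul ha.le,
      show (4 * (3/2) * (3/2+1) : ℝ) = 15 by norm_num, show (3/2/2:ℝ) = 3/4 by norm_num,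
      show ((3/2-1) * (3/2) : ℝ) = 3/4 by norm_num, rpow_neg ha.le]
    have p1 : 0 < A ^ (3/4:ℝ) := by positivity
    have p2 : (0:ℝ) < 15 ^ (3/4:ℝ) := by positivity
    have e2 : r n ^ (2 * (3/2) : ℝ) * r n ^ (-(2 * (3/2)) * (3/2) : ℝ) = (r n ^ (3/2:ℝ))⁻¹ := by
      rw [← rpow_add hρ, ← rpow_neg hρ.le]; norm_num
    calc _ = M n * (r n ^ (2 * (3/2) : ℝ) * r n ^ (-(2 * (3/2)) * (3/2) : ℝ)) := by field_simp
      _ = _ := by rw [e2]; rfl
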